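/- 𝓗¹ coercivity of 𝓛_Γ^T: if α < 10^{-14}, η = 99/100, γ = 1 + α/10, then for every admissible f, (𝓛_Γ^T(f), f)_{𝓗¹} ≥ |f|²_{𝓗¹}, where (f,g)_{𝓗¹} := 10·(D_z f, (D_z g)·w²/sin(2θ)^η)_{L²} + 10^{10}·(f·w, g·w/sin(2θ)^η)_{L²} + 10^{17}·(f·w, g·w)_{L²} + 10^{21}·(D_θ f, (D_θ g)·w²/sin(2θ)^γ)_{L²} and |f|²_{𝓗¹} := ‖f·w/sin(2θ)^{η/2}‖²_{L²} + ‖(D_z f)·w/sin(2θ)^{η/2}‖²_{L²} + ‖(D_θ f)·w/sin(2θ)^{γ/2}‖²_{L²}. -/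

import Mathlib

open Real MeasureTheory Set Filter

noncomputable section

/-- The angular kernel `K(θ) = 3 sin θ cos² θ`. -/
def Kker (θ : ℝ) : ℝ := 3 * Real.sin θ * Real.cos θ ^ 2

/-- `L₁₂(f)(z) = ∫_z^∞ ∫_0^{π/2} f(r,θ) K(θ)/r dθ dr`. -/
def L12 (f : ℝ → ℝ → ℝ) (z : ℝ) : ℝ :=
  ∫ r in Ioi z, ∫ θ in Icc 0 (π / 2), f r θ * Kker θ / r

/-- The radial weight `w(z) = (1+z)²/z²`. -/
def wgt (z : ℝ) : ℝ := (1 + z) ^ 2 / z ^ 2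

/-- `D_θ f = sin(2θ) ∂_θ f`. -/
def Dth (f : ℝ → ℝ → ℝ) (z θ : ℝ) : ℝ := Real.sin (2 * θ) * deriv (fun t => f z t) θ

/-- `D_z f = z ∂_z f`. -/
def Dzr (f : ℝ → ℝ → ℝ) (z θ : ℝ) : ℝ := z * deriv (fun s => f s θ) z

/-- `Γ(θ) = (sin θ cos² θ)^{α/3}`. -/
def Gam (α θ : ℝ) : ℝ := (Real.sin θ * Real.cos θ ^ 2) ^ (α / 3)

/-- `c = ∫_0^{π/2} Γ(θ) K(θ) dθ`. -/
def cGam (α : ℝ) : ℝ := ∫ θ in Icc 0 (π / 2), Gam α θ * Kker θ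

/-- `𝓛(f) = f + z ∂_z f - 2 f/(1+z)`. -/
def Lop (f : ℝ → ℝ → ℝ) (z θ : ℝ) : ℝ :=
  f z θ + z * deriv (fun s => f s θ) z - 2 * f z θ / (1 + z)

/-- `𝓛_Γ(f) = 𝓛(f) - (2zΓ(θ)/(c(1+z)²)) L₁₂(f)`. -/
def LGam (α : ℝ) (f : ℝ → ℝ → ℝ) (z θ : ℝ) : ℝ :=
  Lop f z θ - 2 * z * Gam α θ / (cGam α * (1 + z) ^ 2) * L12 f z

/-- `ℙ(f)(z,θ) = f(z,θ) - (Γ(θ)/c)(2z²/(1+z)³) L₁₂(f)(0)`. -/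
def Pproj (α : ℝ) (f : ℝ → ℝ → ℝ) (z θ : ℝ) : ℝ :=
  f z θ - Gam α θ / cGam α * (2 * z ^ 2 / (1 + z) ^ 3) * L12 f 0

/-- `𝓛_Γ^T(f) = 𝓛_Γ(f) - ℙ((3/(1+z)) D_θ f)`. -/
def LGamT (α : ℝ) (f : ℝ → ℝ → ℝ) (z θ : ℝ) : ℝ :=
  LGam α f z θ - Pproj α (fun z2 θ2 => 3 / (1 + z2) * Dth f z2 θ2) z θ

/-- The `L²` inner product on `[0,∞) × [0,π/2]` with respect to `dz dθ`. -/
def ip (A B : ℝ → ℝ → ℝ) : ℝ :=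
  ∫ z in Ioi (0 : ℝ), ∫ θ in Icc 0 (π / 2), A z θ * B z θ

/-- `f` is admissible: smooth on `[0,∞) × [0,π/2]` and vanishing for `z` outside a
compact subset of `(0,∞)`. -/
def Admissible (f : ℝ → ℝ → ℝ) : Prop :=
  ContDiff ℝ (⊤ : ℕ∞) (Function.uncurry f) ∧
  ∃ a b : ℝ, 0 < a ∧ ∀ z θ : ℝ, z ∉ Icc a b → f z θ = 0


/-- The `𝓗¹` inner product:
`(f,g)_{𝓗¹} = 10(D_z f, (D_z g)·w²/sin(2θ)^η) + 10¹⁰(f·w, g·w/sin(2θ)^η)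
  + 10¹⁷(f·w, g·w) + 10²¹(D_θ f, (D_θ g)·w²/sin(2θ)^γ)`. -/
def ipH1 (η γ : ℝ) (f g : ℝ → ℝ → ℝ) : ℝ :=
  10 * ip (Dzr f) (fun z θ => Dzr g z θ * wgt z ^ 2 / Real.sin (2 * θ) ^ η) +
    10 ^ 10 * ip (fun z θ => f z θ * wgt z)
      (fun z θ => g z θ * wgt z / Real.sin (2 * θ) ^ η) +
    10 ^ 17 * ip (fun z θ => f z θ * wgt z) (fun z θ => g z θ * wgt z) +
    10 ^ 21 * ip (Dth f) (fun z θ => Dth g z θ * wgt z ^ 2 / Real.sin (2 * θ) ^ γ)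

/-- The squared `𝓗¹` norm:
`|f|²_{𝓗¹} = ‖f·w/sin(2θ)^{η/2}‖² + ‖(D_z f)·w/sin(2θ)^{η/2}‖² + ‖(D_θ f)·w/sin(2θ)^{γ/2}‖²`. -/
def H1normSq (η γ : ℝ) (f : ℝ → ℝ → ℝ) : ℝ :=
  ip (fun z θ => f z θ * wgt z / Real.sin (2 * θ) ^ (η / 2))
      (fun z θ => f z θ * wgt z / Real.sin (2 * θ) ^ (η / 2)) +
    ip (fun z θ => Dzr f z θ * wgt z / Real.sin (2 * θ) ^ (η / 2))
      (fun z θ => Dzr f z θ * wgt z / Real.sin (2 * θ) ^ (η / 2)) +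
    ip (fun z θ => Dth f z θ * wgt z / Real.sin (2 * θ) ^ (γ / 2))
      (fun z θ => Dth f z θ * wgt z / Real.sin (2 * θ) ^ (γ / 2))

/-- Lebesgue measure on the open rectangle `(a, b) × (0, π/2)`. -/
def rectMeasure (a b : ℝ) : Measure (ℝ × ℝ) :=
  (volume.restrict (Ioo a b)).prod (volume.restrict (Ioo 0 (π / 2)))

theorem sq_integral_mul_le {X : Type*} [MeasurableSpace X] {μ : Measure X} {u v : X → ℝ}
    (huu : Integrable (fun x => u x ^ 2) μ) (hvv : Integrable (fun x => v x ^ 2) μ)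
    (huv : Integrable (fun x => u x * v x) μ) :
    (∫ x, u x * v x ∂μ) ^ 2 ≤ (∫ x, u x ^ 2 ∂μ) * ∫ x, v x ^ 2 ∂μ := by
  have key : ∀ t : ℝ, 0 ≤ (∫ x, u x ^ 2 ∂μ) * (t * t) + (2 * ∫ x, u x * v x ∂μ) * t +
      ∫ x, v x ^ 2 ∂μ := by
    intro t
    have h0 : 0 ≤ ∫ x, (u x * t + v x) ^ 2 ∂μ := integral_nonneg fun x => sq_nonneg _
    have h1 : ∫ x, (u x * t + v x) ^ 2 ∂μ =
        ∫ x, (t * t * u x ^ 2 + 2 * t * (u x * v x) + v x ^ 2) ∂μ := by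
      congr 1; ext x; ring
    have i1 := huu.const_mul (t * t)
    have i2 := huv.const_mul (2 * t)
    rw [h1, integral_add (f := fun x => t * t * u x ^ 2 + 2 * t * (u x * v x)) (i1.add i2) hvv,
      integral_add i1 i2, integral_const_mul, integral_const_mul] at h0
    linarith
  have := discrim_le_zero key
  unfold discrim at this
  nlinarith

theorem sum_mul_integral_le {X : Type*} [MeasurableSpace X] {μ : Measure X} {n : ℕ}
    (c : Fin n → ℝ) (h : Fin n → X → ℝ) (H : X → ℝ) (hh : ∀ i, Integrable (h i) μ)
    (hH : Integrable H μ) (hle : ∀ᵐ x ∂μ, ∑ i, c i * h i x ≤ H x) :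
    ∑ i, c i * ∫ x, h i x ∂μ ≤ ∫ x, H x ∂μ := by
  have h1 : ∑ i, c i * ∫ x, h i x ∂μ = ∫ x, ∑ i, c i * h i x ∂μ := by
    rw [integral_finsetSum _ fun i _ => (hh i).const_mul _]
    simp_rw [integral_const_mul]
  rw [h1]
  exact integral_mono_ae (integrable_finsetSum _ fun i _ => (hh i).const_mul _) hH hle

theorem ae_rectMeasure {a b : ℝ} {P : ℝ × ℝ → Prop}
    (h : ∀ z ∈ Ioo a b, ∀ θ ∈ Ioo 0 (π / 2), P (z, θ)) : ∀ᵐ x ∂rectMeasure a b, P x := by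
  rw [rectMeasure, Measure.prod_restrict]
  refine ae_restrict_of_forall_mem (measurableSet_Ioo.prod measurableSet_Ioo) ?_
  rintro ⟨z, θ⟩ ⟨h1, h2⟩
  exact h z h1 θ h2

theorem integrable_rectMeasure {a b : ℝ} (ha : 0 < a) {φ : ℝ × ℝ → ℝ}
    (hφ : ContinuousOn φ (Ioi 0 ×ˢ univ)) {ρ : ℝ → ℝ}
    (hρ : IntegrableOn ρ (Ioo 0 (π / 2))) :
    Integrable (fun x => φ x * ρ x.2) (rectMeasure a b) := by
  have hsub : Icc a b ×ˢ Icc 0 (π / 2) ⊆ (Ioi (0 : ℝ) ×ˢ (univ : Set ℝ)) := by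
    rintro ⟨z, θ⟩ ⟨h1, -⟩
    exact ⟨lt_of_lt_of_le ha h1.1, trivial⟩
  obtain ⟨C, hC⟩ := (isCompact_Icc.prod isCompact_Icc).exists_bound_of_continuousOn (hφ.mono hsub)
  have h1 : Integrable (fun x : ℝ × ℝ => ρ x.2) (rectMeasure a b) := by
    have := Integrable.mul_prod (μ := volume.restrict (Ioo a b)) (f := fun _ : ℝ => (1 : ℝ))
      (integrable_const 1) hρ
    simpa [rectMeasure] using this
  refine h1.bdd_mul (c := C) ?_ ?_
  · rw [rectMeasure, Measure.prod_restrict]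
    refine (hφ.mono ?_).aestronglyMeasurable (measurableSet_Ioo.prod measurableSet_Ioo)
    exact (Set.prod_mono Ioo_subset_Icc_self Ioo_subset_Icc_self).trans hsub
  · exact ae_rectMeasure fun z hz θ hθ =>
      hC (z, θ) ⟨Ioo_subset_Icc_self hz, Ioo_subset_Icc_self hθ⟩

theorem integrable_rectMeasure' {a b : ℝ} (ha : 0 < a) {φ : ℝ × ℝ → ℝ}
    (hφ : ContinuousOn φ (Ioi 0 ×ˢ univ)) : Integrable φ (rectMeasure a b) := by
  have := integrable_rectMeasure (b := b) ha hφ (ρ := fun _ => 1) (by simp)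
  simpa using this

theorem integral_rectMeasure {a b : ℝ} {H : ℝ × ℝ → ℝ} (hH : Integrable H (rectMeasure a b)) :
    ∫ x, H x ∂rectMeasure a b = ∫ z in Ioo a b, ∫ θ in Ioo 0 (π / 2), H (z, θ) :=
  integral_prod _ hH

theorem integral_rectMeasure_symm {a b : ℝ} {H : ℝ × ℝ → ℝ}
    (hH : Integrable H (rectMeasure a b)) :
    ∫ x, H x ∂rectMeasure a b = ∫ θ in Ioo 0 (π / 2), ∫ z in Ioo a b, H (z, θ) :=
  integral_prod_symm _ hH

theorem ip_eq_integral {a b : ℝ} (ha : 0 < a) {A B : ℝ → ℝ → ℝ} {H : ℝ × ℝ → ℝ}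
    (hH : Integrable H (rectMeasure a b))
    (heq : ∀ z ∈ Ioo a b, ∀ θ ∈ Ioo 0 (π / 2), A z θ * B z θ = H (z, θ))
    (hvan : ∀ z, z ∉ Ioo a b → ∀ θ, A z θ * B z θ = 0) :
    ip A B = ∫ x, H x ∂rectMeasure a b := by
  rw [integral_rectMeasure hH, ip]
  rw [setIntegral_eq_of_subset_of_forall_sdiff_eq_zero (s := Ioo a b) measurableSet_Ioi
    (fun z hz => lt_trans ha hz.1)]
  · refine setIntegral_congr_fun measurableSet_Ioo fun z hz => ?_
    rw [integral_Icc_eq_integral_Ioo]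
    exact setIntegral_congr_fun measurableSet_Ioo fun θ hθ => heq z hz θ hθ
  · intro z hz
    have h0 := hvan z hz.2
    exact integral_eq_zero_of_ae (Eventually.of_forall h0)

theorem sin_two_mul_pos {θ : ℝ} (hθ : θ ∈ Ioo 0 (π / 2)) : 0 < sin (2 * θ) :=
  sin_pos_of_pos_of_lt_pi (by linarith [hθ.1]) (by linarith [hθ.2])

theorem le_sin_two_mul {θ : ℝ} (hθ : θ ∈ Icc 0 (π / 4)) : 4 / π * θ ≤ sin (2 * θ) := by
  have := Real.mul_le_sin (x := 2 * θ) (by linarith [hθ.1]) (by linarith [hθ.2])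
  calc 4 / π * θ = 2 / π * (2 * θ) := by ring
    _ ≤ _ := this

theorem min_le_sin_two_mul {θ : ℝ} (hθ : θ ∈ Icc 0 (π / 2)) :
    4 / π * min θ (π / 2 - θ) ≤ sin (2 * θ) := by
  rcases le_total θ (π / 4) with h | h
  · rw [min_eq_left (by linarith)]
    exact le_sin_two_mul ⟨hθ.1, h⟩
  · rw [min_eq_right (by linarith)]
    have := le_sin_two_mul (θ := π / 2 - θ) ⟨by linarith [hθ.2], by linarith⟩
    rwa [show 2 * (π / 2 - θ) = π - 2 * θ by ring, sin_pi_sub] at this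

theorem rpow_neg_sin_le {s θ : ℝ} (hs : 0 ≤ s) (hθ : θ ∈ Ioo 0 (π / 2)) :
    sin (2 * θ) ^ (-s) ≤ (4 / π * θ) ^ (-s) + (4 / π * (π / 2 - θ)) ^ (-s) := by
  have h := min_le_sin_two_mul (Ioo_subset_Icc_self hθ)
  have h1 : 0 < 4 / π * θ := mul_pos (by positivity) hθ.1
  have h2 : 0 < 4 / π * (π / 2 - θ) := mul_pos (by positivity) (by linarith [hθ.2])
  rcases le_total θ (π / 2 - θ) with h3 | h3
  · rw [min_eq_left h3] at h
    have := rpow_le_rpow_of_nonpos h1 h (neg_nonpos.2 hs)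
    have := rpow_pos_of_pos h2 (-s)
    linarith
  · rw [min_eq_right h3] at h
    have := rpow_le_rpow_of_nonpos h2 h (neg_nonpos.2 hs)
    have := rpow_pos_of_pos h1 (-s)
    linarith

theorem continuousOn_rpow_sin (s : ℝ) :
    ContinuousOn (fun θ => sin (2 * θ) ^ s) (Ioo 0 (π / 2)) := by
  refine ContinuousOn.rpow_const (by fun_prop) fun θ hθ => Or.inl (sin_two_mul_pos hθ).ne'

theorem integral_rpow_neg_sin {s : ℝ} (hs : 0 ≤ s) (hs1 : s < 1) :
    IntegrableOn (fun θ => sin (2 * θ) ^ (-s)) (Ioo 0 (π / 2)) ∧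
      ∫ θ in Ioo 0 (π / 2), sin (2 * θ) ^ (-s) ≤ 4 / (1 - s) := by
  have hpi := Real.pi_pos
  have i0 : IntervalIntegrable (fun x : ℝ => x ^ (-s)) volume 0 2 :=
    intervalIntegral.intervalIntegrable_rpow' (by linarith)
  have i1 : IntervalIntegrable (fun θ : ℝ => (4 / π * θ) ^ (-s)) volume 0 (π / 2) := by
    have := i0.comp_mul_left (c := 4 / π) 
    rwa [zero_div, show 2 / (4 / π) = π / 2 by field_simp; norm_num] at this
  have i2 : IntervalIntegrable (fun θ : ℝ => (4 / π * (π / 2 - θ)) ^ (-s)) volume 0 (π / 2) := by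
    have := (i1.comp_sub_left (π / 2)).symm
    simpa using this
  have e1 : ∫ θ in (0 : ℝ)..(π / 2), (4 / π * θ) ^ (-s) = π / 4 * (2 ^ (1 - s) / (1 - s)) := by
    rw [intervalIntegral.integral_comp_mul_left (fun x => x ^ (-s)) (by positivity),
      integral_rpow (Or.inl (by linarith))]
    rw [show 4 / π * (π / 2) = 2 by field_simp; norm_num, mul_zero, zero_rpow (by linarith),
      show -s + 1 = 1 - s by ring, smul_eq_mul]
    simp
  have e2 : ∫ θ in (0 : ℝ)..(π / 2), (4 / π * (π / 2 - θ)) ^ (-s) =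
      π / 4 * (2 ^ (1 - s) / (1 - s)) := by
    rw [intervalIntegral.integral_comp_sub_left (fun x => (4 / π * x) ^ (-s))]
    simpa using e1
  have hle : (0 : ℝ) ≤ π / 2 := by positivity
  rw [intervalIntegrable_iff_integrableOn_Ioo_of_le hle] at i1 i2
  have hI : IntegrableOn (fun θ => sin (2 * θ) ^ (-s)) (Ioo 0 (π / 2)) := by
    refine Integrable.mono' (i1.add i2)
      ((continuousOn_rpow_sin (-s)).aestronglyMeasurable measurableSet_Ioo) ?_
    refine ae_restrict_of_forall_mem measurableSet_Ioo fun θ hθ => ?_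
    rw [norm_of_nonneg (rpow_nonneg (sin_two_mul_pos hθ).le _)]
    exact rpow_neg_sin_le hs hθ
  refine ⟨hI, ?_⟩
  have h2 : (2 : ℝ) ^ (1 - s) ≤ 2 := by
    calc (2 : ℝ) ^ (1 - s) ≤ 2 ^ (1 : ℝ) := rpow_le_rpow_of_exponent_le (by norm_num) (by linarith)
      _ = 2 := by simp
  calc ∫ θ in Ioo 0 (π / 2), sin (2 * θ) ^ (-s)
      ≤ ∫ θ in Ioo 0 (π / 2), ((4 / π * θ) ^ (-s) + (4 / π * (π / 2 - θ)) ^ (-s)) :=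
        setIntegral_mono_on hI (i1.add i2) measurableSet_Ioo fun θ hθ => rpow_neg_sin_le hs hθ
    _ = π / 4 * (2 ^ (1 - s) / (1 - s)) + π / 4 * (2 ^ (1 - s) / (1 - s)) := by
        rw [integral_add i1 i2]
        rw [intervalIntegral.integral_of_le hle, integral_Ioc_eq_integral_Ioo] at e1 e2
        rw [e1, e2]
    _ ≤ 4 / (1 - s) := by
        have : π / 4 * (2 ^ (1 - s) / (1 - s)) + π / 4 * (2 ^ (1 - s) / (1 - s)) =
          (π / 2 * 2 ^ (1 - s)) / (1 - s) := by ring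
        rw [this]
        refine div_le_div_of_nonneg_right ?_ (by linarith)
        nlinarith [Real.pi_lt_four]

theorem integrableOn_rpow_sin {s : ℝ} (hs : -1 < s) :
    IntegrableOn (fun θ => sin (2 * θ) ^ s) (Ioo 0 (π / 2)) := by
  rcases le_or_gt s 0 with h | h
  · have := (integral_rpow_neg_sin (s := -s) (by linarith) (by linarith)).1
    simpa using this
  · have : Continuous fun θ : ℝ => sin (2 * θ) ^ s :=
      Continuous.rpow_const (by fun_prop) fun _ => Or.inr h.le
    exact (this.integrableOn_Icc (a := 0) (b := π / 2)).mono_set Ioo_subset_Icc_self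

theorem setIntegral_Ioo_eq_sub {a b : ℝ} (hab : a ≤ b) {F F' : ℝ → ℝ}
    (hF : ContinuousOn F (Icc a b)) (hd : ∀ x ∈ Ioo a b, HasDerivAt F (F' x) x)
    (hi : IntegrableOn F' (Ioo a b)) : ∫ x in Ioo a b, F' x = F b - F a := by
  rw [← integral_Ioc_eq_integral_Ioo, ← intervalIntegral.integral_of_le hab]
  exact intervalIntegral.integral_eq_sub_of_hasDerivAt_of_le hab hF hd
    ((intervalIntegrable_iff_integrableOn_Ioo_of_le hab).2 hi)

theorem integrableOn_Ioo_of_pos {a b : ℝ} (ha : 0 < a) {φ : ℝ → ℝ}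
    (hφ : ContinuousOn φ (Ioi 0)) : IntegrableOn φ (Ioo a b) :=
  ((hφ.mono fun _ hx => lt_of_lt_of_le ha hx.1).integrableOn_Icc
    (a := a) (b := b)).mono_set Ioo_subset_Icc_self

theorem hasDerivAt_wgt {z : ℝ} (hz : 0 < z) :
    HasDerivAt wgt (-(2 / (1 + z)) * wgt z / z) z := by
  have h1 : HasDerivAt (fun x : ℝ => (1 + x) ^ 2 / x ^ 2)
      ((2 * (1 + z) * z ^ 2 - (1 + z) ^ 2 * (2 * z)) / (z ^ 2) ^ 2) z := by
    have hn : HasDerivAt (fun x : ℝ => (1 + x) ^ 2) (2 * (1 + z)) z := by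
      simpa using ((hasDerivAt_id' z).const_add 1).fun_pow 2
    have hd : HasDerivAt (fun x : ℝ => x ^ 2) (2 * z) z := by
      simpa using (hasDerivAt_id' z).fun_pow 2
    exact hn.fun_div hd (by positivity)
  refine h1.congr_deriv ?_
  rw [wgt]
  field_simp
  ring

theorem wgt_pos {z : ℝ} (hz : 0 < z) : 0 < wgt z := by unfold wgt; positivity

theorem four_div_le_wgt {z : ℝ} (hz : 0 < z) : 4 / z ≤ wgt z := by
  unfold wgt
  rw [div_le_div_iff₀ hz (by positivity)]
  nlinarith [mul_nonneg hz.le (sq_nonneg (1 - z))]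

theorem continuousOn_wgt : ContinuousOn wgt (Ioi 0) := fun _ hz =>
  (hasDerivAt_wgt hz).continuousAt.continuousWithinAt

theorem continuousOn_fst_comp {k : ℝ → ℝ} (hk : ContinuousOn k (Ioi 0)) :
    ContinuousOn (fun x : ℝ × ℝ => k x.1) (Ioi 0 ×ˢ univ) :=
  hk.comp continuousOn_fst fun _ hx => hx.1

theorem continuousOn_inv_one_add : ContinuousOn (fun z : ℝ => 1 / (1 + z)) (Ioi 0) :=
  continuousOn_const.div (by fun_prop) fun z hz => by
    have : (0 : ℝ) < z := hz
    positivity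

theorem integrableOn_continuous_mul {φ ρ : ℝ → ℝ} (hφ : Continuous φ)
    (hρ : IntegrableOn ρ (Ioo 0 (π / 2))) :
    IntegrableOn (fun θ => φ θ * ρ θ) (Ioo 0 (π / 2)) := by
  obtain ⟨C, hC⟩ := isCompact_Icc.exists_bound_of_continuousOn
    (hφ.continuousOn (s := Icc 0 (π / 2)))
  exact Integrable.bdd_mul hρ hφ.aestronglyMeasurable
    (ae_restrict_of_forall_mem measurableSet_Ioo fun θ hθ => hC θ (Ioo_subset_Icc_self hθ))

theorem integral_radial_transport_eq_zero {a b : ℝ} (ha : 0 < a) (hab : a < b)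
    {u u1 : ℝ × ℝ → ℝ} (hu : Continuous u) (hu1 : Continuous u1)
    (hd : ∀ z θ, HasDerivAt (fun s => u (s, θ)) (u1 (z, θ)) z)
    (hua : ∀ θ, u (a, θ) = 0) (hub : ∀ θ, u (b, θ) = 0) {ρ : ℝ → ℝ}
    (hρ : IntegrableOn ρ (Ioo 0 (π / 2))) :
    Integrable (fun x => wgt x.1 ^ 2 *
      (x.1 * u1 x * u x + (1 / 2 - 2 * (1 / (1 + x.1))) * u x ^ 2) * ρ x.2) (rectMeasure a b) ∧
    ∫ x, wgt x.1 ^ 2 * (x.1 * u1 x * u x + (1 / 2 - 2 * (1 / (1 + x.1))) * u x ^ 2) * ρ x.2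
      ∂rectMeasure a b = 0 := by
  have hw := continuousOn_fst_comp continuousOn_wgt
  have hv := continuousOn_fst_comp continuousOn_inv_one_add
  have hcont : ContinuousOn (fun x : ℝ × ℝ => wgt x.1 ^ 2 *
      (x.1 * u1 x * u x + (1 / 2 - 2 * (1 / (1 + x.1))) * u x ^ 2)) (Ioi 0 ×ˢ univ) := by
    refine (hw.pow 2).mul (ContinuousOn.add (by fun_prop) (ContinuousOn.mul ?_ (by fun_prop)))
    exact continuousOn_const.sub (continuousOn_const.mul hv)
  have hi := integrable_rectMeasure (b := b) ha hcont hρ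
  refine ⟨hi, ?_⟩
  rw [integral_rectMeasure_symm hi]
  refine integral_eq_zero_of_ae (Eventually.of_forall fun θ => ?_)
  simp only [Pi.zero_apply]
  rw [integral_mul_const]
  have h0 := setIntegral_Ioo_eq_sub (F := fun z => 1 / 2 * z * wgt z ^ 2 * u (z, θ) ^ 2)
    (F' := fun z => wgt z ^ 2 *
      (z * u1 (z, θ) * u (z, θ) + (1 / 2 - 2 * (1 / (1 + z))) * u (z, θ) ^ 2)) hab.le
    (ContinuousOn.mul (ContinuousOn.mul (by fun_prop)
      ((continuousOn_wgt.mono fun z hz => lt_of_lt_of_le ha hz.1).pow 2)) (by fun_prop))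
    (fun z hz => by
      have hz0 : 0 < z := ha.trans hz.1
      have := (((hasDerivAt_id' z).const_mul (1 / 2)).fun_mul ((hasDerivAt_wgt hz0).fun_pow 2)).fun_mul
        ((hd z θ).fun_pow 2)
      refine this.congr_deriv ?_
      simp
      field_simp
      ring)
    (integrableOn_Ioo_of_pos ha (hcont.comp (Continuous.continuousOn (by fun_prop))
      fun z hz => ⟨hz, trivial⟩ : ContinuousOn ((fun x : ℝ × ℝ => wgt x.1 ^ 2 *
      (x.1 * u1 x * u x + (1 / 2 - 2 * (1 / (1 + x.1))) * u x ^ 2)) ∘ fun z => (z, θ)) (Ioi 0)))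
  rw [h0, hua, hub]
  ring

theorem integral_angular_transport_eq_zero {a b : ℝ} (ha : 0 < a)
    {u u2 : ℝ × ℝ → ℝ} (hu : Continuous u) (hu2 : Continuous u2)
    (hd : ∀ z θ, HasDerivAt (fun t => u (z, t)) (u2 (z, θ)) θ) {k : ℝ → ℝ}
    (hk : ContinuousOn k (Ioi 0)) {s : ℝ} (hs : s < 1) :
    Integrable (fun x => k x.1 * (2 * u x * u2 x) * sin (2 * x.2) ^ (1 - s) +
      k x.1 * (2 * (1 - s) * cos (2 * x.2) * u x ^ 2) * sin (2 * x.2) ^ (-s)) (rectMeasure a b) ∧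
    ∫ x, (k x.1 * (2 * u x * u2 x) * sin (2 * x.2) ^ (1 - s) +
      k x.1 * (2 * (1 - s) * cos (2 * x.2) * u x ^ 2) * sin (2 * x.2) ^ (-s))
      ∂rectMeasure a b = 0 := by
  have hk' := continuousOn_fst_comp hk
  have hi := (integrable_rectMeasure (b := b) ha
    (φ := fun x => k x.1 * (2 * u x * u2 x)) (hk'.mul (by fun_prop))
    (integrableOn_rpow_sin (s := 1 - s) (by linarith))).fun_add
    (integrable_rectMeasure (b := b) ha
    (φ := fun x => k x.1 * (2 * (1 - s) * cos (2 * x.2) * u x ^ 2)) (hk'.mul (by fun_prop))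
    (integrableOn_rpow_sin (s := -s) (by linarith)))
  refine ⟨hi, ?_⟩
  rw [integral_rectMeasure hi]
  refine integral_eq_zero_of_ae (Eventually.of_forall fun z => ?_)
  simp only [Pi.zero_apply]
  have hpi := Real.pi_pos
  have h0 := setIntegral_Ioo_eq_sub (a := 0) (b := π / 2)
    (F := fun θ => sin (2 * θ) ^ (1 - s) * u (z, θ) ^ 2)
    (F' := fun θ => 2 * u (z, θ) * u2 (z, θ) * sin (2 * θ) ^ (1 - s) +
      (2 * (1 - s) * cos (2 * θ) * u (z, θ) ^ 2) * sin (2 * θ) ^ (-s)) (by positivity)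
    (Continuous.continuousOn (Continuous.mul
      (Continuous.rpow_const (by fun_prop) fun _ => Or.inr (by linarith)) (by fun_prop)))
    (fun θ hθ => by
      have hs0 := sin_two_mul_pos hθ
      have e1 : HasDerivAt (fun t => sin (2 * t)) (cos (2 * θ) * 2) θ := by
        simpa using ((hasDerivAt_id' θ).const_mul 2).sin
      have := (e1.rpow_const (p := 1 - s) (Or.inl hs0.ne')).fun_mul ((hd z θ).fun_pow 2)
      refine this.congr_deriv ?_
      simp only [show 1 - s - 1 = -s by ring]
      push_cast
      ring)
    ((integrableOn_continuous_mul (φ := fun θ => 2 * u (z, θ) * u2 (z, θ)) (by fun_prop)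
      (integrableOn_rpow_sin (s := 1 - s) (by linarith))).fun_add
      (integrableOn_continuous_mul (φ := fun θ => 2 * (1 - s) * cos (2 * θ) * u (z, θ) ^ 2)
        (by fun_prop) (integrableOn_rpow_sin (s := -s) (by linarith))))
  have h1 : ∀ θ, k z * (2 * u (z, θ) * u2 (z, θ)) * sin (2 * θ) ^ (1 - s) +
      k z * (2 * (1 - s) * cos (2 * θ) * u (z, θ) ^ 2) * sin (2 * θ) ^ (-s) =
      k z * (2 * u (z, θ) * u2 (z, θ) * sin (2 * θ) ^ (1 - s) +
      (2 * (1 - s) * cos (2 * θ) * u (z, θ) ^ 2) * sin (2 * θ) ^ (-s)) := fun θ => by ring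
  simp only [h1]
  rw [integral_const_mul, h0]
  have h2 : sin (2 * (π / 2)) = 0 := by rw [mul_div_cancel₀ _ two_ne_zero, sin_pi]
  simp [h2, zero_rpow (show (1 - s) ≠ 0 by linarith)]

theorem integral_sq_div_le {a b : ℝ} (ha : 0 < a) (hab : a < b) {G g : ℝ → ℝ}
    (hg : Continuous g) (hG : Continuous G) (hd : ∀ z, 0 < z → HasDerivAt G (-(g z / z)) z)
    (hGa : G a = 0) (hGb : G b = 0) :
    ∫ z in Ioo a b, (G z / z) ^ 2 ≤ 4 * ∫ z in Ioo a b, (g z / z) ^ 2 := by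
  have hne : ∀ z ∈ Ioi (0 : ℝ), z ≠ 0 := fun z hz => (mem_Ioi.1 hz).ne'
  have c1 : ContinuousOn (fun z => (G z / z) ^ 2) (Ioi 0) :=
    (hG.continuousOn.div continuousOn_id hne).pow 2
  have c2 : ContinuousOn (fun z => (g z / z) ^ 2) (Ioi 0) :=
    (hg.continuousOn.div continuousOn_id hne).pow 2
  have c3 : ContinuousOn (fun z => (G z / z) ^ 2 + 2 * (G z / z) * (g z / z)) (Ioi 0) :=
    c1.add ((continuousOn_const.mul (hG.continuousOn.div continuousOn_id hne)).mul
      (hg.continuousOn.div continuousOn_id hne))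
  have hFc : ContinuousOn (fun z => -(G z ^ 2 / z)) (Icc a b) :=
    ((hG.continuousOn.pow 2).div continuousOn_id fun z hz => (ha.trans_le hz.1).ne').neg
  have h0 := setIntegral_Ioo_eq_sub (F := fun z => -(G z ^ 2 / z)) hab.le hFc
    (F' := fun z => (G z / z) ^ 2 + 2 * (G z / z) * (g z / z))
    (fun z hz => by
      have hz0 : 0 < z := ha.trans hz.1
      have := (((hd z hz0).fun_pow 2).fun_div (hasDerivAt_id' z) hz0.ne').fun_neg
      refine this.congr_deriv ?_
      simp
      field_simp
      ring) (integrableOn_Ioo_of_pos ha c3)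
  simp only [hGa, hGb] at h0
  have h1 := setIntegral_mono_on (μ := volume) (s := Ioo a b)
    (f := fun z => 1 / 2 * (G z / z) ^ 2 - 2 * (g z / z) ^ 2)
    (Integrable.sub' ((integrableOn_Ioo_of_pos ha c1).const_mul (1 / 2))
      ((integrableOn_Ioo_of_pos ha c2).const_mul 2))
    (integrableOn_Ioo_of_pos ha c3) measurableSet_Ioo
    (fun z _ => by nlinarith [sq_nonneg (G z / z + 2 * (g z / z))])
  rw [integral_sub ((integrableOn_Ioo_of_pos ha c1).const_mul (1 / 2))
      ((integrableOn_Ioo_of_pos ha c2).const_mul 2), integral_const_mul, integral_const_mul,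
      h0] at h1
  norm_num at h1
  linarith

theorem integral_div_mul_wgt_mul_nonpos {a b : ℝ} (ha : 0 < a) (hab : a < b) {G g : ℝ → ℝ}
    (hg : Continuous g) (hG : Continuous G) (hd : ∀ z, 0 < z → HasDerivAt G (-(g z / z)) z)
    (hGa : G a = 0) (hGb : G b = 0) :
    ∫ z in Ioo a b, G z / z * wgt z * g z ≤ 0 := by
  have hne : ∀ z ∈ Ioi (0 : ℝ), z ≠ 0 := fun z hz => (mem_Ioi.1 hz).ne'
  have c1 : ContinuousOn (fun z => G z / z * wgt z * g z) (Ioi 0) :=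
    ((hG.continuousOn.div continuousOn_id hne).mul continuousOn_wgt).mul hg.continuousOn
  have c2 : ContinuousOn (fun z => 2 / (1 + z) * wgt z / z * G z ^ 2) (Ioi 0) := by
    refine ContinuousOn.mul (ContinuousOn.div (ContinuousOn.mul (continuousOn_const.div (by fun_prop)
      fun z hz => ?_) continuousOn_wgt) continuousOn_id hne) (by fun_prop)
    have : (0 : ℝ) < z := hz
    positivity
  have i1 := (integrableOn_Ioo_of_pos (b := b) ha c1)
  have i2 := (integrableOn_Ioo_of_pos (b := b) ha c2)
  have h0 := setIntegral_Ioo_eq_sub (F := fun z => wgt z * G z ^ 2) hab.le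
    ((continuousOn_wgt.mono fun z hz => lt_of_lt_of_le ha hz.1).mul (by fun_prop))
    (F' := fun z => -2 * (G z / z * wgt z * g z) - 2 / (1 + z) * wgt z / z * G z ^ 2)
    (fun z hz => by
      have hz0 : 0 < z := ha.trans hz.1
      have := (hasDerivAt_wgt hz0).fun_mul ((hd z hz0).fun_pow 2)
      refine this.congr_deriv ?_
      simp
      ring) (Integrable.sub' (i1.const_mul (-2)) i2)
  rw [integral_sub (i1.const_mul (-2)) i2, integral_const_mul] at h0
  simp only [hGa, hGb] at h0
  have h2 : 0 ≤ ∫ z in Ioo a b, 2 / (1 + z) * wgt z / z * G z ^ 2 := by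
    refine setIntegral_nonneg measurableSet_Ioo fun z hz => ?_
    have hz0 : 0 < z := ha.trans hz.1
    have := wgt_pos hz0
    positivity
  norm_num at h0
  linarith

theorem integral_inv_one_add_sq_le {a b : ℝ} (ha : 0 < a) (hab : a < b) :
    ∫ z in Ioo a b, (1 / (1 + z)) ^ 2 ≤ 1 := by
  have h0 := setIntegral_Ioo_eq_sub (F := fun z => -(1 / (1 + z))) hab.le
    ((continuousOn_inv_one_add.mono fun z hz => lt_of_lt_of_le ha hz.1).neg)
    (F' := fun z => (1 / (1 + z)) ^ 2)
    (fun z hz => by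
      have hz0 : 0 < 1 + z := by linarith [hz.1]
      have := ((hasDerivAt_const z (1 : ℝ)).fun_div ((hasDerivAt_id' z).const_add 1) hz0.ne').fun_neg
      refine this.congr_deriv ?_
      field_simp
      ring) (integrableOn_Ioo_of_pos ha (continuousOn_inv_one_add.pow 2))
  rw [h0]
  have h1 : 1 / (1 + a) ≤ 1 := by rw [div_le_one (by linarith)]; linarith
  have h2 : 0 ≤ 1 / (1 + b) := by have := ha.trans hab; positivity
  linarith

theorem continuous_Kker : Continuous Kker := by unfold Kker; fun_prop

theorem sin_nonneg_of_mem {θ : ℝ} (hθ : θ ∈ Icc 0 (π / 2)) : 0 ≤ sin θ :=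
  sin_nonneg_of_nonneg_of_le_pi hθ.1 (by linarith [hθ.2, Real.pi_pos])

theorem cos_nonneg_of_mem {θ : ℝ} (hθ : θ ∈ Icc 0 (π / 2)) : 0 ≤ cos θ :=
  cos_nonneg_of_neg_pi_div_two_le_of_le (by linarith [hθ.1, Real.pi_pos]) hθ.2

theorem Kker_nonneg {θ : ℝ} (hθ : θ ∈ Icc 0 (π / 2)) : 0 ≤ Kker θ := by
  have := sin_nonneg_of_mem hθ
  unfold Kker
  positivity

theorem Kker_le {θ : ℝ} (hθ : θ ∈ Icc 0 (π / 2)) : Kker θ ≤ 3 / 2 := by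
  have h1 := sin_nonneg_of_mem hθ
  have h2 := cos_nonneg_of_mem hθ
  have h3 : sin θ * cos θ ≤ 1 / 2 := by
    nlinarith [sq_nonneg (sin θ - cos θ), sin_sq_add_cos_sq θ]
  have h4 := cos_le_one θ
  have h5 : sin θ * cos θ * cos θ ≤ 1 / 2 * 1 :=
    mul_le_mul h3 h4 h2 (by norm_num)
  unfold Kker
  nlinarith

theorem integral_Kker : ∫ θ in Ioo 0 (π / 2), Kker θ = 1 := by
  have := setIntegral_Ioo_eq_sub (a := 0) (b := π / 2) (F := fun θ => -cos θ ^ 3) (F' := Kker)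
    (by positivity) (by fun_prop)
    (fun θ _ => by
      refine ((hasDerivAt_cos θ).fun_pow 3).fun_neg.congr_deriv ?_
      simp [Kker]
      ring)
    ((continuous_Kker.integrableOn_Icc).mono_set Ioo_subset_Icc_self)
  rw [this]
  simp

theorem continuous_Gam {α : ℝ} (hα : 0 < α) : Continuous (Gam α) :=
  Continuous.rpow_const (by fun_prop) fun _ => Or.inr (by positivity)

theorem sin_mul_cos_sq_le {θ : ℝ} (hθ : θ ∈ Icc 0 (π / 2)) : sin θ * cos θ ^ 2 ≤ 1 := by
  have := Kker_le hθ
  unfold Kker at this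
  linarith

theorem Gam_nonneg {α θ : ℝ} (hθ : θ ∈ Icc 0 (π / 2)) : 0 ≤ Gam α θ := by
  have := sin_nonneg_of_mem hθ
  unfold Gam
  positivity

theorem Gam_le_one {α θ : ℝ} (hα : 0 < α) (hθ : θ ∈ Icc 0 (π / 2)) : Gam α θ ≤ 1 := by
  have := sin_nonneg_of_mem hθ
  exact rpow_le_one (by positivity) (sin_mul_cos_sq_le hθ) (by positivity)

theorem Kker_sub_le {α θ : ℝ} (hα : 0 < α) (hθ : θ ∈ Ioo 0 (π / 2)) :
    Kker θ - α ≤ Gam α θ * Kker θ := by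
  have h1 : 0 < sin θ := sin_pos_of_pos_of_lt_pi hθ.1 (by linarith [hθ.2, Real.pi_pos])
  have h2 : 0 < cos θ := cos_pos_of_mem_Ioo ⟨by linarith [hθ.1, Real.pi_pos], hθ.2⟩
  unfold Kker Gam
  set x := sin θ * cos θ ^ 2 with hx
  have hx0 : 0 < x := by positivity
  have h3 : 1 + log x * (α / 3) ≤ x ^ (α / 3) := by
    rw [rpow_def_of_pos hx0]
    linarith [add_one_le_exp (log x * (α / 3))]
  have h4 := one_sub_inv_le_log_of_pos hx0
  have h5 : 1 + (1 - x⁻¹) * (α / 3) ≤ x ^ (α / 3) := by nlinarith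
  have h6 := mul_le_mul_of_nonneg_right h5 hx0.le
  have h7 : (1 + (1 - x⁻¹) * (α / 3)) * x = x + (α / 3) * x - α / 3 := by field_simp; ring
  rw [h7] at h6
  have : 0 < α / 3 * x := by positivity
  have e : 3 * sin θ * cos θ ^ 2 = 3 * x := by rw [hx]; ring
  rw [e]
  nlinarith

theorem integrableOn_of_continuous {φ : ℝ → ℝ} (h : Continuous φ) (a b : ℝ) :
    IntegrableOn φ (Ioo a b) :=
  h.integrableOn_Icc.mono_set Ioo_subset_Icc_self

theorem integral_const_angle (C : ℝ) : ∫ _ in Ioo 0 (π / 2), C = π / 2 * C := by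
  have : (0 : ℝ) ≤ π / 2 := by positivity
  simp [this]

theorem nine_tenths_le_cGam {α : ℝ} (hα : 0 < α) (hα' : α < 1 / 100) : 9 / 10 ≤ cGam α := by
  unfold cGam
  rw [integral_Icc_eq_integral_Ioo]
  have h := setIntegral_mono_on (μ := volume) (s := Ioo 0 (π / 2)) (f := fun θ => Kker θ - α)
    (g := fun θ => Gam α θ * Kker θ)
    (integrableOn_of_continuous (continuous_Kker.sub continuous_const) _ _)
    (integrableOn_of_continuous ((continuous_Gam hα).mul continuous_Kker) _ _)
    measurableSet_Ioo fun θ hθ => Kker_sub_le hα hθ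
  rw [integral_sub (integrableOn_of_continuous continuous_Kker _ _)
    (integrableOn_of_continuous continuous_const _ _), integral_Kker, integral_const_angle] at h
  nlinarith [Real.pi_lt_four]

theorem sq_integral_mul_le_of_integral_eq_zero {u h h' : ℝ → ℝ} (hu : Continuous u)
    (hh : Continuous h) (hh' : Continuous h') (hd : ∀ θ, HasDerivAt h (h' θ) θ) {C : ℝ}
    (hC : ∀ θ ∈ Icc 0 (π / 2), |u θ| ≤ C) (h0 : ∫ θ in Ioo 0 (π / 2), u θ = 0) :
    (∫ θ in Ioo 0 (π / 2), u θ * h θ) ^ 2 ≤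
      π / 2 * (C * (π / 4)) ^ 2 * ∫ θ in Ioo 0 (π / 2), (sin (2 * θ) * h' θ) ^ 2 := by
  have hpi : (0 : ℝ) ≤ π / 2 := by positivity
  have hC0 : 0 ≤ C := (abs_nonneg _).trans (hC 0 ⟨le_rfl, hpi⟩)
  set U : ℝ → ℝ := fun θ => ∫ t in (0 : ℝ)..θ, u t with hU
  have hUd : ∀ θ, HasDerivAt U (u θ) θ := fun θ => (hu.integral_hasStrictDerivAt 0 θ).hasDerivAt
  have hUc : Continuous U := continuous_iff_continuousAt.2 fun θ => (hUd θ).continuousAt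
  have hUe : U (π / 2) = 0 := by
    rw [hU]
    simp only
    rw [intervalIntegral.integral_of_le hpi, integral_Ioc_eq_integral_Ioo, h0]
  have hbound : ∀ x ∈ Icc 0 (π / 2), ∀ y ∈ Icc 0 (π / 2), |U y - U x| ≤ C * |y - x| := by
    intro x hx y hy
    have : U y - U x = ∫ t in x..y, u t := by
      rw [hU]
      simp only
      rw [intervalIntegral.integral_interval_sub_left] <;> exact hu.intervalIntegrable _ _
    rw [this, ← Real.norm_eq_abs]
    refine intervalIntegral.norm_integral_le_of_norm_le_const fun t ht => ?_
    exact hC t ((uIcc_subset_Icc hx hy) (uIoc_subset_uIcc ht))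
  have hUb : ∀ θ ∈ Icc 0 (π / 2), |U θ| ≤ C * (π / 4) * sin (2 * θ) := by
    intro θ hθ
    have b1 := hbound 0 ⟨le_rfl, hpi⟩ θ hθ
    have b2 := hbound (π / 2) ⟨hpi, le_rfl⟩ θ hθ
    rw [show U 0 = 0 by simp [hU], sub_zero, sub_zero, abs_of_nonneg hθ.1] at b1
    rw [hUe, sub_zero, abs_sub_comm θ, abs_of_nonneg (by linarith [hθ.2] : 0 ≤ π / 2 - θ)] at b2
    have b3 : |U θ| ≤ C * min θ (π / 2 - θ) := by
      rcases min_choice θ (π / 2 - θ) with h | h <;> rw [h] <;> assumption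
    have b4 := min_le_sin_two_mul hθ
    calc |U θ| ≤ C * min θ (π / 2 - θ) := b3
      _ = C * (π / 4) * (4 / π * min θ (π / 2 - θ)) := by
        have := Real.pi_pos
        field_simp
      _ ≤ _ := mul_le_mul_of_nonneg_left b4 (by positivity)
  have hparts := setIntegral_Ioo_eq_sub (a := 0) (b := π / 2) (F := fun θ => U θ * h θ)
    (F' := fun θ => u θ * h θ + U θ * h' θ) hpi (by fun_prop)
    (fun θ _ => (hUd θ).fun_mul (hd θ)) (integrableOn_of_continuous (by fun_prop) _ _)
  rw [integral_add (integrableOn_of_continuous (by fun_prop) _ _)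
    (integrableOn_of_continuous (by fun_prop) _ _), hUe, show U 0 = 0 by simp [hU]] at hparts
  have e1 : ∫ θ in Ioo 0 (π / 2), u θ * h θ = -∫ θ in Ioo 0 (π / 2), 1 * (U θ * h' θ) := by
    simp only [one_mul]
    linarith
  have hcs := sq_integral_mul_le (μ := volume.restrict (Ioo 0 (π / 2))) (u := fun _ => (1 : ℝ))
    (v := fun θ => U θ * h' θ) (integrableOn_of_continuous (by fun_prop) _ _)
    (integrableOn_of_continuous (by fun_prop) _ _) (integrableOn_of_continuous (by fun_prop) _ _)
  rw [integral_const_angle] at hcs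
  rw [e1, neg_sq]
  refine hcs.trans ?_
  rw [one_pow, mul_one, mul_assoc (π / 2), ← integral_const_mul ((C * (π / 4)) ^ 2)]
  refine mul_le_mul_of_nonneg_left ?_ hpi
  refine setIntegral_mono_on (integrableOn_of_continuous (by fun_prop) _ _)
    (integrableOn_of_continuous (by fun_prop) _ _) measurableSet_Ioo fun θ hθ => ?_
  have b := hUb θ (Ioo_subset_Icc_self hθ)
  have b' : U θ ^ 2 ≤ (C * (π / 4) * sin (2 * θ)) ^ 2 := sq_le_sq' (by linarith [neg_abs_le (U θ)])
    (by linarith [le_abs_self (U θ)])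
  nlinarith [mul_le_mul_of_nonneg_right b' (sq_nonneg (h' θ))]

theorem integral_Gam_mem {α : ℝ} (hα : 0 < α) :
    (∫ θ in Ioo 0 (π / 2), Gam α θ) ∈ Icc 0 (π / 2) := by
  constructor
  · exact setIntegral_nonneg measurableSet_Ioo fun θ hθ => Gam_nonneg (Ioo_subset_Icc_self hθ)
  · have := setIntegral_mono_on (integrableOn_of_continuous (continuous_Gam hα) 0 (π / 2))
      (integrableOn_of_continuous (continuous_const (y := (1 : ℝ))) _ _) measurableSet_Ioo
      fun θ hθ => Gam_le_one hα (Ioo_subset_Icc_self hθ)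
    rwa [integral_const_angle, mul_one] at this

theorem sq_integral_Gam_mul_sub_le {α : ℝ} (hα : 0 < α) {h h' : ℝ → ℝ}
    (hh : Continuous h) (hh' : Continuous h') (hd : ∀ θ, HasDerivAt h (h' θ) θ) :
    ((∫ θ in Ioo 0 (π / 2), Gam α θ * h θ) -
      (∫ θ in Ioo 0 (π / 2), Gam α θ) * ∫ θ in Ioo 0 (π / 2), h θ * Kker θ) ^ 2 ≤
      12 * ∫ θ in Ioo 0 (π / 2), (sin (2 * θ) * h' θ) ^ 2 := by
  have hΓ := continuous_Gam hα
  have hK := continuous_Kker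
  obtain ⟨m0, m1⟩ := integral_Gam_mem hα
  set m := ∫ θ in Ioo 0 (π / 2), Gam α θ
  have hpi := Real.pi_lt_d2
  have hpi3 := Real.pi_gt_three
  have key := sq_integral_mul_le_of_integral_eq_zero (u := fun θ => Gam α θ - m * Kker θ)
    (by fun_prop) hh hh' hd (C := 12 / 5) (fun θ hθ => by
      have h1 := Gam_nonneg (α := α) hθ
      have h2 := Gam_le_one hα hθ
      have h3 := Kker_nonneg hθ
      have h4 := Kker_le hθ
      rw [abs_le]
      constructor <;> nlinarith [mul_nonneg m0 h3]) (by
      rw [integral_sub (integrableOn_of_continuous hΓ _ _)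
        (integrableOn_of_continuous (by fun_prop) _ _), integral_const_mul, integral_Kker]
      exact sub_eq_zero.2 (mul_one m).symm)
  have e : ∫ θ in Ioo 0 (π / 2), (Gam α θ - m * Kker θ) * h θ =
      (∫ θ in Ioo 0 (π / 2), Gam α θ * h θ) - m * ∫ θ in Ioo 0 (π / 2), h θ * Kker θ := by
    rw [← integral_const_mul, ← integral_sub (integrableOn_of_continuous (by fun_prop) _ _)
        (integrableOn_of_continuous (by fun_prop) _ _)]
    congr 1
    ext θ
    ring
  rw [e] at key
  refine key.trans (mul_le_mul_of_nonneg_right ?_ (integral_nonneg fun _ => sq_nonneg _))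
  have : π ^ 3 ≤ 3.15 ^ 3 := by gcongr
  nlinarith

theorem sq_integral_mul_Kker_le {h : ℝ → ℝ} (hh : Continuous h) :
    (∫ θ in Ioo 0 (π / 2), h θ * Kker θ) ^ 2 ≤ 18 / 5 * ∫ θ in Ioo 0 (π / 2), h θ ^ 2 := by
  have hK := continuous_Kker
  have hcs := sq_integral_mul_le (μ := volume.restrict (Ioo 0 (π / 2))) (u := Kker)
    (v := h) (integrableOn_of_continuous (by fun_prop) _ _)
    (integrableOn_of_continuous (by fun_prop) _ _) (integrableOn_of_continuous (by fun_prop) _ _)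
  simp only [mul_comm (h _)]
  refine hcs.trans (mul_le_mul_of_nonneg_right ?_ (integral_nonneg fun _ => sq_nonneg _))
  have := setIntegral_mono_on (integrableOn_of_continuous (φ := fun θ => Kker θ ^ 2)
      (by fun_prop) 0 (π / 2))
    (integrableOn_of_continuous (continuous_const (y := (9 / 4 : ℝ))) _ _) measurableSet_Ioo
    fun θ hθ => by
      have h1 := Kker_nonneg (Ioo_subset_Icc_self hθ)
      have h2 := Kker_le (Ioo_subset_Icc_self hθ)
      nlinarith
  rw [integral_const_angle] at this
  linarith [Real.pi_lt_d2]

theorem hasDerivAt_Gam {α θ : ℝ} (hθ : θ ∈ Ioo 0 (π / 2)) :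
    ∃ G', HasDerivAt (Gam α) G' θ ∧
      sin (2 * θ) * G' = 2 / 3 * α * (cos θ ^ 2 - 2 * sin θ ^ 2) * Gam α θ := by
  have h1 : 0 < sin θ := sin_pos_of_pos_of_lt_pi hθ.1 (by linarith [hθ.2, Real.pi_pos])
  have h2 : 0 < cos θ := cos_pos_of_mem_Ioo ⟨by linarith [hθ.1, Real.pi_pos], hθ.2⟩
  have hx : 0 < sin θ * cos θ ^ 2 := by positivity
  have hd := ((hasDerivAt_sin θ).fun_mul ((hasDerivAt_cos θ).fun_pow 2)).rpow_const
    (p := α / 3) (Or.inl hx.ne')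
  refine ⟨_, hd, ?_⟩
  rw [rpow_sub_one hx.ne', sin_two_mul, Gam]
  field_simp
  ring

theorem Gam_sq_mul_rpow_le {α θ : ℝ} (hα : 0 < α) (hθ : θ ∈ Ioo 0 (π / 2)) :
    Gam α θ ^ 2 * sin (2 * θ) ^ (-(1 + α / 10)) ≤ sin (2 * θ) ^ (-(1 - 17 * α / 30)) := by
  have h0 := sin_two_mul_pos hθ
  have h1 := sin_nonneg_of_mem (Ioo_subset_Icc_self hθ)
  have h2 := cos_nonneg_of_mem (Ioo_subset_Icc_self hθ)
  have h3 : sin θ * cos θ ^ 2 ≤ sin (2 * θ) := by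
    rw [sin_two_mul]
    nlinarith [cos_le_one θ, mul_nonneg h1 h2]
  have h4 : Gam α θ ≤ sin (2 * θ) ^ (α / 3) :=
    rpow_le_rpow (by positivity) h3 (by positivity)
  calc Gam α θ ^ 2 * sin (2 * θ) ^ (-(1 + α / 10))
      ≤ (sin (2 * θ) ^ (α / 3)) ^ 2 * sin (2 * θ) ^ (-(1 + α / 10)) := by
        gcongr
        exact Gam_nonneg (Ioo_subset_Icc_self hθ)
    _ = _ := by
        rw [← rpow_natCast, ← rpow_mul h0.le, ← rpow_add h0]
        congr 1
        push_cast
        ring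

/-- A smooth function on `ℝ × ℝ` supported in the strip `a < z < b`, with its partial derivatives
of order at most two and the tail integral `G` of its `K`-average divided by `z`. -/
structure StripData where
  a : ℝ
  b : ℝ
  a_pos : 0 < a
  a_lt_b : a < b
  F : ℝ × ℝ → ℝ
  F1 : ℝ × ℝ → ℝ
  F2 : ℝ × ℝ → ℝ
  F11 : ℝ × ℝ → ℝ
  F12 : ℝ × ℝ → ℝ
  F22 : ℝ × ℝ → ℝ
  cF : Continuous F
  cF1 : Continuous F1
  cF2 : Continuous F2
  cF11 : Continuous F11
  cF12 : Continuous F12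
  cF22 : Continuous F22
  d1 : ∀ z θ, HasDerivAt (fun s => F (s, θ)) (F1 (z, θ)) z
  d2 : ∀ z θ, HasDerivAt (fun t => F (z, t)) (F2 (z, θ)) θ
  d11 : ∀ z θ, HasDerivAt (fun s => F1 (s, θ)) (F11 (z, θ)) z
  d12 : ∀ z θ, HasDerivAt (fun t => F1 (z, t)) (F12 (z, θ)) θ
  d21 : ∀ z θ, HasDerivAt (fun s => F2 (s, θ)) (F12 (z, θ)) z
  d22 : ∀ z θ, HasDerivAt (fun t => F2 (z, t)) (F22 (z, θ)) θ
  van : ∀ z, z ∉ Ioo a b → ∀ θ, F (z, θ) = 0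
  van1 : ∀ z, z ∉ Ioo a b → ∀ θ, F1 (z, θ) = 0
  van2 : ∀ z, z ∉ Ioo a b → ∀ θ, F2 (z, θ) = 0
  G : ℝ → ℝ
  cG : Continuous G
  cg : Continuous fun z => ∫ θ in Ioo 0 (π / 2), F (z, θ) * Kker θ
  dG : ∀ z, 0 < z → HasDerivAt G (-((∫ θ in Ioo 0 (π / 2), F (z, θ) * Kker θ) / z)) z
  Ga : G a = 0
  Gb : G b = 0

namespace StripData

variable (P : StripData)

/-- The `K`-average of `F` over the angle. -/
def g (z : ℝ) : ℝ := ∫ θ in Ioo 0 (π / 2), P.F (z, θ) * Kker θ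

/-- The value at `0` of `L₁₂` applied to `3 / (1 + z) * D_θ F`. -/
def ell : ℝ := ∫ x, 3 / (x.1 * (1 + x.1)) * (sin (2 * x.2) * P.F2 x * Kker x.2) ∂rectMeasure P.a P.b

/-- The nonlocal radial coefficient of `𝓛_Γ^T`, multiplied by the weight. -/
def R (z : ℝ) : ℝ := -2 * (P.G z / z) + 2 * P.ell * (1 / (1 + z))

/-- The nonlocal radial coefficient of `D_z 𝓛_Γ^T`, multiplied by the weight. -/
def R1 (z : ℝ) : ℝ := -2 * ((1 - z) * (1 / (1 + z))) * (P.G z / z) + 2 * (P.g z / z) +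
  2 * ((2 - z) * (1 / (1 + z))) * P.ell * (1 / (1 + z))

theorem continuous_g : Continuous P.g := P.cg

theorem continuousOn_G_div : ContinuousOn (fun z => P.G z / z) (Ioi 0) :=
  P.cG.continuousOn.div continuousOn_id fun _ hz => (mem_Ioi.1 hz).ne'

theorem continuousOn_g_div : ContinuousOn (fun z => P.g z / z) (Ioi 0) :=
  P.continuous_g.continuousOn.div continuousOn_id fun _ hz => (mem_Ioi.1 hz).ne'

theorem continuousOn_R : ContinuousOn P.R (Ioi 0) :=
  (continuousOn_const.mul P.continuousOn_G_div).add (continuousOn_const.mul continuousOn_inv_one_add)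

theorem continuousOn_R1 : ContinuousOn P.R1 (Ioi 0) := by
  have h := continuousOn_inv_one_add
  have h1 := P.continuousOn_G_div
  have h2 := P.continuousOn_g_div
  unfold R1
  fun_prop

theorem integrableOn_rho : IntegrableOn (fun θ => sin (2 * θ) ^ (-(99 / 100) : ℝ)) (Ioo 0 (π / 2)) :=
  integrableOn_rpow_sin (by norm_num)

end StripData

theorem mul_mul_ge_of_sq_le {y : ℝ} (hy : y ^ 2 ≤ 100 / 81) (X R : ℝ) :
    -(X ^ 2 / 20 + 7 * R ^ 2) ≤ y * R * X := by
  nlinarith [sq_nonneg (X + 10 * (y * R)), mul_le_mul_of_nonneg_right hy (sq_nonneg R), sq_nonneg R]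

theorem Gam_div_cGam_sq_le {α θ : ℝ} (hα : 0 < α) (hα' : α < 1 / 100) (hθ : θ ∈ Icc 0 (π / 2)) :
    (Gam α θ / cGam α) ^ 2 ≤ 100 / 81 := by
  have hc := nine_tenths_le_cGam hα hα'
  have h1 := Gam_nonneg (α := α) hθ
  have h2 := Gam_le_one hα hθ
  rw [div_pow, div_le_iff₀ (by positivity)]
  nlinarith

namespace StripData

variable (P : StripData)

theorem integral_weighted_ge {α : ℝ} (hα : 0 < α) (hα' : α < 1 / 100) :
    Integrable (fun x => (wgt x.1 ^ 2 * ((P.F x + x.1 * P.F1 x - 2 * P.F x * (1 / (1 + x.1)) -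
        3 * (1 / (1 + x.1)) * (sin (2 * x.2) * P.F2 x)) * P.F x) +
        Gam α x.2 / cGam α * P.R x.1 * (wgt x.1 * P.F x)) * sin (2 * x.2) ^ (-(99 / 100) : ℝ))
        (rectMeasure P.a P.b) ∧
    42 / 100 * (∫ x, (wgt x.1 * P.F x) ^ 2 * sin (2 * x.2) ^ (-(99 / 100) : ℝ)
        ∂rectMeasure P.a P.b) -
      7 * (∫ x, P.R x.1 ^ 2 * sin (2 * x.2) ^ (-(99 / 100) : ℝ) ∂rectMeasure P.a P.b) ≤
      ∫ x, (wgt x.1 ^ 2 * ((P.F x + x.1 * P.F1 x - 2 * P.F x * (1 / (1 + x.1)) -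
        3 * (1 / (1 + x.1)) * (sin (2 * x.2) * P.F2 x)) * P.F x) +
        Gam α x.2 / cGam α * P.R x.1 * (wgt x.1 * P.F x)) * sin (2 * x.2) ^ (-(99 / 100) : ℝ)
        ∂rectMeasure P.a P.b := by
  have hρ := integrableOn_rho
  have hv := continuousOn_fst_comp continuousOn_inv_one_add
  have hw := continuousOn_fst_comp continuousOn_wgt
  have hR := continuousOn_fst_comp P.continuousOn_R
  have cF := P.cF.continuousOn (s := Ioi (0 : ℝ) ×ˢ (univ : Set ℝ))
  have cF1 := P.cF1.continuousOn (s := Ioi (0 : ℝ) ×ˢ (univ : Set ℝ))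
  have cF2 := P.cF2.continuousOn (s := Ioi (0 : ℝ) ×ˢ (univ : Set ℝ))
  have cΓ : ContinuousOn (fun x : ℝ × ℝ => Gam α x.2) (Ioi 0 ×ˢ univ) :=
    ((continuous_Gam hα).comp continuous_snd).continuousOn
  have hH := integrable_rectMeasure (b := P.b) P.a_pos (φ := fun x : ℝ × ℝ =>
    wgt x.1 ^ 2 * ((P.F x + x.1 * P.F1 x - 2 * P.F x * (1 / (1 + x.1)) -
        3 * (1 / (1 + x.1)) * (sin (2 * x.2) * P.F2 x)) * P.F x) +
        Gam α x.2 / cGam α * P.R x.1 * (wgt x.1 * P.F x)) (by fun_prop) hρ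
  refine ⟨hH, ?_⟩
  have n1 := integral_radial_transport_eq_zero P.a_pos P.a_lt_b P.cF P.cF1 P.d1
    (P.van _ (by simp)) (P.van _ (by simp)) hρ
  have n2 := integral_angular_transport_eq_zero (b := P.b) P.a_pos P.cF P.cF2 P.d2
    (k := fun z => 3 * (1 / (1 + z)) * wgt z ^ 2)
    ((continuousOn_const.mul continuousOn_inv_one_add).mul (continuousOn_wgt.pow 2))
    (s := 99 / 100) (by norm_num)
  have i1 := integrable_rectMeasure (b := P.b) P.a_pos
    (φ := fun x => (wgt x.1 * P.F x) ^ 2) (by fun_prop) hρ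
  have i2 := integrable_rectMeasure (b := P.b) P.a_pos
    (φ := fun x => P.R x.1 ^ 2) (by fun_prop) hρ
  have := sum_mul_integral_le ![42 / 100, -7, 1, -(1 / 2)] ![_, _, _, _] _
    (by simpa [Fin.forall_fin_succ] using ⟨i1, i2, n1.1, n2.1⟩) hH ?_
  · simp only [Fin.sum_univ_four, Matrix.cons_val] at this
    rw [n1.2, n2.2] at this
    linarith
  refine ae_rectMeasure fun z hz θ hθ => ?_
  simp only [Fin.sum_univ_four, Matrix.cons_val]
  have hS := sin_two_mul_pos hθ
  rw [show (1 - 99 / 100 : ℝ) = 1 + -(99 / 100) by norm_num, rpow_add hS, rpow_one]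
  have hρ0 := rpow_pos_of_pos hS (-(99 / 100))
  set ρ := sin (2 * θ) ^ (-(99 / 100) : ℝ)
  have hz0 : 0 < z := P.a_pos.trans hz.1
  have hv0 : 0 < 1 / (1 + z) := by positivity
  have hv1 : 1 / (1 + z) ≤ 1 := by rw [div_le_one (by positivity)]; linarith
  have hC : -1 ≤ 1 / (1 + z) * cos (2 * θ) := by
    nlinarith [neg_one_le_cos (2 * θ)]
  have key := mul_mul_ge_of_sq_le (Gam_div_cGam_sq_le hα hα' (Ioo_subset_Icc_self hθ))
    (wgt z * P.F (z, θ)) (P.R z)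
  have k2 := mul_le_mul_of_nonneg_right hC (sq_nonneg (wgt z * P.F (z, θ)))
  have k3 := mul_le_mul_of_nonneg_right (add_le_add key
    (mul_le_mul_of_nonneg_left k2 (by norm_num : (0 : ℝ) ≤ 3 / 100))) hρ0.le
  linarith
end StripData

theorem sin_two_mul_sq_le {α θ : ℝ} (hα : 0 < α) (hθ : θ ∈ Ioo 0 (π / 2)) :
    sin (2 * θ) ^ 2 ≤ sin (2 * θ) ^ (1 - α / 10) := by
  rw [← rpow_two]
  exact rpow_le_rpow_of_exponent_ge (sin_two_mul_pos hθ) (sin_le_one _) (by linarith)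

theorem inv_one_add_bounds {z : ℝ} (hz : 0 < z) : 0 < 1 / (1 + z) ∧ 1 / (1 + z) ≤ 1 ∧
    z * (1 / (1 + z)) ^ 2 ≤ 1 / 4 := by
  refine ⟨by positivity, by rw [div_le_one (by positivity)]; linarith, ?_⟩
  rw [div_pow, one_pow, mul_one_div, div_le_div_iff₀ (by positivity) (by positivity)]
  nlinarith [sq_nonneg (1 - z)]

namespace StripData

variable (P : StripData)

theorem integral_unweighted_ge {α : ℝ} (hα : 0 < α) (hα' : α < 1 / 100) :
    Integrable (fun x => wgt x.1 ^ 2 * ((P.F x + x.1 * P.F1 x - 2 * P.F x * (1 / (1 + x.1)) -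
        3 * (1 / (1 + x.1)) * (sin (2 * x.2) * P.F2 x)) * P.F x) +
        Gam α x.2 / cGam α * P.R x.1 * (wgt x.1 * P.F x)) (rectMeasure P.a P.b) ∧
    3 / 10 * (∫ x, (wgt x.1 * P.F x) ^ 2 ∂rectMeasure P.a P.b) -
      13 * (∫ x, (P.ell * (1 / (1 + x.1))) ^ 2 ∂rectMeasure P.a P.b) -
      23 * (∫ x, (wgt x.1 * P.F2 x) ^ 2 * sin (2 * x.2) ^ (1 - α / 10) ∂rectMeasure P.a P.b) -
      2 / cGam α * (∫ x, P.G x.1 / x.1 * wgt x.1 * (Gam α x.2 * P.F x) ∂rectMeasure P.a P.b) ≤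
      ∫ x, (wgt x.1 ^ 2 * ((P.F x + x.1 * P.F1 x - 2 * P.F x * (1 / (1 + x.1)) -
        3 * (1 / (1 + x.1)) * (sin (2 * x.2) * P.F2 x)) * P.F x) +
        Gam α x.2 / cGam α * P.R x.1 * (wgt x.1 * P.F x)) ∂rectMeasure P.a P.b := by
  have hv := continuousOn_fst_comp continuousOn_inv_one_add
  have hw := continuousOn_fst_comp continuousOn_wgt
  have hR := continuousOn_fst_comp P.continuousOn_R
  have hG := continuousOn_fst_comp P.continuousOn_G_div
  have cF := P.cF.continuousOn (s := Ioi (0 : ℝ) ×ˢ (univ : Set ℝ))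
  have cF1 := P.cF1.continuousOn (s := Ioi (0 : ℝ) ×ˢ (univ : Set ℝ))
  have cF2 := P.cF2.continuousOn (s := Ioi (0 : ℝ) ×ˢ (univ : Set ℝ))
  have cΓ : ContinuousOn (fun x : ℝ × ℝ => Gam α x.2) (Ioi 0 ×ˢ univ) :=
    ((continuous_Gam hα).comp continuous_snd).continuousOn
  have hH := integrable_rectMeasure' (b := P.b) P.a_pos (φ := fun x : ℝ × ℝ =>
    wgt x.1 ^ 2 * ((P.F x + x.1 * P.F1 x - 2 * P.F x * (1 / (1 + x.1)) -
        3 * (1 / (1 + x.1)) * (sin (2 * x.2) * P.F2 x)) * P.F x) +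
        Gam α x.2 / cGam α * P.R x.1 * (wgt x.1 * P.F x)) (by fun_prop)
  refine ⟨hH, ?_⟩
  have n1 := integral_radial_transport_eq_zero P.a_pos P.a_lt_b P.cF P.cF1 P.d1
    (P.van _ (by simp)) (P.van _ (by simp)) (ρ := fun _ => 1) (by simp)
  have i1 := integrable_rectMeasure' (b := P.b) P.a_pos
    (φ := fun x => (wgt x.1 * P.F x) ^ 2) (by fun_prop)
  have i2 := integrable_rectMeasure' (b := P.b) P.a_pos
    (φ := fun x => (P.ell * (1 / (1 + x.1))) ^ 2) (by fun_prop)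
  have i3 := integrable_rectMeasure (b := P.b) P.a_pos
    (φ := fun x => (wgt x.1 * P.F2 x) ^ 2) (by fun_prop)
    (integrableOn_rpow_sin (s := 1 - α / 10) (by linarith))
  have i4 := integrable_rectMeasure' (b := P.b) P.a_pos
    (φ := fun x => P.G x.1 / x.1 * wgt x.1 * (Gam α x.2 * P.F x)) (by fun_prop)
  have := sum_mul_integral_le ![3 / 10, -13, -23, -(2 / cGam α), 1] ![_, _, _, _, _] _
    (by simpa [Fin.forall_fin_succ] using ⟨i1, i2, i3, i4, n1.1⟩) hH ?_
  · simp only [Fin.sum_univ_five, Matrix.cons_val] at this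
    rw [n1.2] at this
    linarith
  refine ae_rectMeasure fun z hz θ hθ => ?_
  simp only [Fin.sum_univ_five, Matrix.cons_val]
  have hz0 : 0 < z := P.a_pos.trans hz.1
  obtain ⟨hv0, hv1, -⟩ := inv_one_add_bounds hz0
  have hy := Gam_div_cGam_sq_le hα hα' (Ioo_subset_Icc_self hθ)
  have hT := mul_le_mul_of_nonneg_left (sin_two_mul_sq_le hα hθ)
    (sq_nonneg (wgt z * P.F2 (z, θ)))
  have key1 : -((wgt z * P.F (z, θ)) ^ 2 / 10 + 13 * (P.ell * (1 / (1 + z))) ^ 2) ≤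
      2 * (Gam α θ / cGam α * (P.ell * (1 / (1 + z))) * (wgt z * P.F (z, θ))) := by
    nlinarith [sq_nonneg (wgt z * P.F (z, θ) + 10 * (Gam α θ / cGam α * (P.ell * (1 / (1 + z))))),
      mul_le_mul_of_nonneg_right hy (sq_nonneg (P.ell * (1 / (1 + z)))),
      sq_nonneg (P.ell * (1 / (1 + z)))]
  have hv2 : (1 / (1 + z)) ^ 2 ≤ 1 := pow_le_one₀ hv0.le hv1
  have key2 : -((wgt z * P.F (z, θ)) ^ 2 / 10 +
      45 / 2 * ((wgt z * P.F2 (z, θ)) ^ 2 * sin (2 * θ) ^ 2)) ≤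
      -(3 * (1 / (1 + z)) * (wgt z * P.F2 (z, θ) * sin (2 * θ)) * (wgt z * P.F (z, θ))) := by
    nlinarith [sq_nonneg (wgt z * P.F (z, θ) -
      15 * ((1 / (1 + z)) * (wgt z * P.F2 (z, θ) * sin (2 * θ)))),
      mul_le_mul_of_nonneg_right hv2 (sq_nonneg (wgt z * P.F2 (z, θ) * sin (2 * θ)))]
  have h0 : 0 ≤ (wgt z * P.F2 (z, θ)) ^ 2 * sin (2 * θ) ^ 2 := by positivity
  have hRe : Gam α θ / cGam α * P.R z * (wgt z * P.F (z, θ)) =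
      -(2 / cGam α) * (P.G z / z * wgt z * (Gam α θ * P.F (z, θ))) +
      2 * (Gam α θ / cGam α * (P.ell * (1 / (1 + z))) * (wgt z * P.F (z, θ))) := by
    unfold R; ring
  rw [hRe]
  linarith

theorem integral_Dz_ge {α : ℝ} (hα : 0 < α) (hα' : α < 1 / 100) :
    Integrable (fun x => (wgt x.1 ^ 2 * ((x.1 * P.F1 x + x.1 * (P.F1 x + x.1 * P.F11 x) -
        2 * (x.1 * P.F1 x) * (1 / (1 + x.1)) + 2 * (x.1 * (1 / (1 + x.1)) ^ 2) * P.F x +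
        3 * (x.1 * (1 / (1 + x.1)) ^ 2) * (sin (2 * x.2) * P.F2 x) -
        3 * (1 / (1 + x.1)) * (sin (2 * x.2) * (x.1 * P.F12 x))) * (x.1 * P.F1 x)) +
        Gam α x.2 / cGam α * P.R1 x.1 * (wgt x.1 * (x.1 * P.F1 x))) *
        sin (2 * x.2) ^ (-(99 / 100) : ℝ)) (rectMeasure P.a P.b) ∧
    32 / 100 * (∫ x, (wgt x.1 * (x.1 * P.F1 x)) ^ 2 * sin (2 * x.2) ^ (-(99 / 100) : ℝ)
        ∂rectMeasure P.a P.b) -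
      5 / 4 * (∫ x, (wgt x.1 * P.F x) ^ 2 * sin (2 * x.2) ^ (-(99 / 100) : ℝ)
        ∂rectMeasure P.a P.b) -
      3 * (∫ x, (wgt x.1 * P.F2 x) ^ 2 * sin (2 * x.2) ^ (1 - α / 10) ∂rectMeasure P.a P.b) -
      7 * (∫ x, P.R1 x.1 ^ 2 * sin (2 * x.2) ^ (-(99 / 100) : ℝ) ∂rectMeasure P.a P.b) ≤
    ∫ x, (wgt x.1 ^ 2 * ((x.1 * P.F1 x + x.1 * (P.F1 x + x.1 * P.F11 x) -
        2 * (x.1 * P.F1 x) * (1 / (1 + x.1)) + 2 * (x.1 * (1 / (1 + x.1)) ^ 2) * P.F x +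
        3 * (x.1 * (1 / (1 + x.1)) ^ 2) * (sin (2 * x.2) * P.F2 x) -
        3 * (1 / (1 + x.1)) * (sin (2 * x.2) * (x.1 * P.F12 x))) * (x.1 * P.F1 x)) +
        Gam α x.2 / cGam α * P.R1 x.1 * (wgt x.1 * (x.1 * P.F1 x))) *
        sin (2 * x.2) ^ (-(99 / 100) : ℝ) ∂rectMeasure P.a P.b := by
  have hρ := integrableOn_rho
  have hv := continuousOn_fst_comp continuousOn_inv_one_add
  have hw := continuousOn_fst_comp continuousOn_wgt
  have hR := continuousOn_fst_comp P.continuousOn_R1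
  have cF := P.cF.continuousOn (s := Ioi (0 : ℝ) ×ˢ (univ : Set ℝ))
  have cF1 := P.cF1.continuousOn (s := Ioi (0 : ℝ) ×ˢ (univ : Set ℝ))
  have cF2 := P.cF2.continuousOn (s := Ioi (0 : ℝ) ×ˢ (univ : Set ℝ))
  have cF11 := P.cF11.continuousOn (s := Ioi (0 : ℝ) ×ˢ (univ : Set ℝ))
  have cF12 := P.cF12.continuousOn (s := Ioi (0 : ℝ) ×ˢ (univ : Set ℝ))
  have cΓ : ContinuousOn (fun x : ℝ × ℝ => Gam α x.2) (Ioi 0 ×ˢ univ) :=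
    ((continuous_Gam hα).comp continuous_snd).continuousOn
  have hH := integrable_rectMeasure (b := P.b) P.a_pos (φ := fun x : ℝ × ℝ =>
    wgt x.1 ^ 2 * ((x.1 * P.F1 x + x.1 * (P.F1 x + x.1 * P.F11 x) -
        2 * (x.1 * P.F1 x) * (1 / (1 + x.1)) + 2 * (x.1 * (1 / (1 + x.1)) ^ 2) * P.F x +
        3 * (x.1 * (1 / (1 + x.1)) ^ 2) * (sin (2 * x.2) * P.F2 x) -
        3 * (1 / (1 + x.1)) * (sin (2 * x.2) * (x.1 * P.F12 x))) * (x.1 * P.F1 x)) +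
        Gam α x.2 / cGam α * P.R1 x.1 * (wgt x.1 * (x.1 * P.F1 x))) (by fun_prop) hρ
  refine ⟨hH, ?_⟩
  have c1 := P.cF1
  have c11 := P.cF11
  have c12 := P.cF12
  have n1 := integral_radial_transport_eq_zero P.a_pos P.a_lt_b
    (u := fun x => x.1 * P.F1 x) (u1 := fun x => P.F1 x + x.1 * P.F11 x)
    (by fun_prop) (by fun_prop)
    (fun z θ => ((hasDerivAt_id' z).fun_mul (P.d11 z θ)).congr_deriv (by ring))
    (fun θ => by simp [P.van1 P.a (by simp)]) (fun θ => by simp [P.van1 P.b (by simp)]) hρ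
  have n2 := integral_angular_transport_eq_zero (b := P.b) P.a_pos
    (u := fun x => x.1 * P.F1 x) (u2 := fun x => x.1 * P.F12 x)
    (by fun_prop) (by fun_prop) (fun z θ => (P.d12 z θ).const_mul z)
    (k := fun z => 3 * (1 / (1 + z)) * wgt z ^ 2)
    ((continuousOn_const.mul continuousOn_inv_one_add).mul (continuousOn_wgt.pow 2))
    (s := 99 / 100) (by norm_num)
  have i0 := integrable_rectMeasure (b := P.b) P.a_pos
    (φ := fun x => (wgt x.1 * (x.1 * P.F1 x)) ^ 2) (by fun_prop) hρ
  have i1 := integrable_rectMeasure (b := P.b) P.a_pos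
    (φ := fun x => (wgt x.1 * P.F x) ^ 2) (by fun_prop) hρ
  have i2 := integrable_rectMeasure (b := P.b) P.a_pos
    (φ := fun x => (wgt x.1 * P.F2 x) ^ 2) (by fun_prop)
    (integrableOn_rpow_sin (s := 1 - α / 10) (by linarith))
  have i3 := integrable_rectMeasure (b := P.b) P.a_pos
    (φ := fun x => P.R1 x.1 ^ 2) (by fun_prop) hρ
  have := sum_mul_integral_le ![32 / 100, -(5 / 4), -3, -7, 1, -(1 / 2)] ![_, _, _, _, _, _] _
    (by simpa [Fin.forall_fin_succ] using ⟨i0, i1, i2, i3, n1.1, n2.1⟩) hH ?_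
  · simp only [Fin.sum_univ_six, Matrix.cons_val] at this
    rw [n1.2, n2.2] at this
    linarith
  refine ae_rectMeasure fun z hz θ hθ => ?_
  simp only [Fin.sum_univ_six, Matrix.cons_val]
  have hS := sin_two_mul_pos hθ
  have hT : (wgt z * P.F2 (z, θ) * sin (2 * θ)) ^ 2 * sin (2 * θ) ^ (-(99 / 100) : ℝ) ≤
      (wgt z * P.F2 (z, θ)) ^ 2 * sin (2 * θ) ^ (1 - α / 10) := by
    rw [mul_pow, mul_assoc, ← rpow_two (sin (2 * θ)), ← rpow_add hS]
    exact mul_le_mul_of_nonneg_left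
      (rpow_le_rpow_of_exponent_ge hS (sin_le_one _) (by linarith)) (sq_nonneg _)
  rw [show (1 - 99 / 100 : ℝ) = 1 + -(99 / 100) by norm_num, rpow_add hS, rpow_one]
  have hρ0 := rpow_pos_of_pos hS (-(99 / 100))
  set ρ := sin (2 * θ) ^ (-(99 / 100) : ℝ)
  have hz0 : 0 < z := P.a_pos.trans hz.1
  obtain ⟨hv0, hv1, hv2⟩ := inv_one_add_bounds hz0
  have hC : -1 ≤ 1 / (1 + z) * cos (2 * θ) := by
    nlinarith [neg_one_le_cos (2 * θ)]
  have key := mul_mul_ge_of_sq_le (Gam_div_cGam_sq_le hα hα' (Ioo_subset_Icc_self hθ))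
    (wgt z * (z * P.F1 (z, θ))) (P.R1 z)
  have k2 := mul_le_mul_of_nonneg_right hC (sq_nonneg (wgt z * (z * P.F1 (z, θ))))
  have hm : (z * (1 / (1 + z)) ^ 2) ^ 2 ≤ (1 / 4) ^ 2 := by gcongr
  have k3 : -((wgt z * (z * P.F1 (z, θ))) ^ 2 / 20 + 5 / 4 * (wgt z * P.F (z, θ)) ^ 2) ≤
      2 * (z * (1 / (1 + z)) ^ 2) * (wgt z * P.F (z, θ)) * (wgt z * (z * P.F1 (z, θ))) := by
    nlinarith [sq_nonneg (wgt z * (z * P.F1 (z, θ)) +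
      20 * ((z * (1 / (1 + z)) ^ 2) * (wgt z * P.F (z, θ)))),
      mul_le_mul_of_nonneg_right hm (sq_nonneg (wgt z * P.F (z, θ)))]
  have k4 : -((wgt z * (z * P.F1 (z, θ))) ^ 2 / 20 +
      3 * (wgt z * P.F2 (z, θ) * sin (2 * θ)) ^ 2) ≤
      3 * (z * (1 / (1 + z)) ^ 2) * (wgt z * P.F2 (z, θ) * sin (2 * θ)) *
        (wgt z * (z * P.F1 (z, θ))) := by
    nlinarith [sq_nonneg (wgt z * (z * P.F1 (z, θ)) +
      30 * ((z * (1 / (1 + z)) ^ 2) * (wgt z * P.F2 (z, θ) * sin (2 * θ)))),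
      mul_le_mul_of_nonneg_right hm (sq_nonneg (wgt z * P.F2 (z, θ) * sin (2 * θ))),
      sq_nonneg (wgt z * P.F2 (z, θ) * sin (2 * θ))]
  have k5 := mul_le_mul_of_nonneg_right (add_le_add (add_le_add (add_le_add key
    (mul_le_mul_of_nonneg_left k2 (by norm_num : (0 : ℝ) ≤ 3 / 100))) k3) k4) hρ0.le
  linarith

theorem integral_Dth_ge {α : ℝ} (hα : 0 < α) (hα' : α < 1 / 100) :
    Integrable (fun x => wgt x.1 ^ 2 * ((P.F2 x + x.1 * P.F12 x - 2 * P.F2 x * (1 / (1 + x.1)) -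
        3 * (1 / (1 + x.1)) * (2 * cos (2 * x.2) * P.F2 x + sin (2 * x.2) * P.F22 x)) * P.F2 x) *
        sin (2 * x.2) ^ (1 - α / 10) +
      2 / 3 * α * (cos x.2 ^ 2 - 2 * sin x.2 ^ 2) * (Gam α x.2 / cGam α) * P.R x.1 *
        (wgt x.1 * P.F2 x) * sin (2 * x.2) ^ (-(α / 10))) (rectMeasure P.a P.b) ∧
    39 / 100 * (∫ x, (wgt x.1 * P.F2 x) ^ 2 * sin (2 * x.2) ^ (1 - α / 10)
        ∂rectMeasure P.a P.b) -
      6 * α ^ 2 * (∫ x, P.R x.1 ^ 2 * sin (2 * x.2) ^ (-(1 - 17 * α / 30))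
        ∂rectMeasure P.a P.b) ≤
    ∫ x, (wgt x.1 ^ 2 * ((P.F2 x + x.1 * P.F12 x - 2 * P.F2 x * (1 / (1 + x.1)) -
        3 * (1 / (1 + x.1)) * (2 * cos (2 * x.2) * P.F2 x + sin (2 * x.2) * P.F22 x)) * P.F2 x) *
        sin (2 * x.2) ^ (1 - α / 10) +
      2 / 3 * α * (cos x.2 ^ 2 - 2 * sin x.2 ^ 2) * (Gam α x.2 / cGam α) * P.R x.1 *
        (wgt x.1 * P.F2 x) * sin (2 * x.2) ^ (-(α / 10))) ∂rectMeasure P.a P.b := by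
  have hv := continuousOn_fst_comp continuousOn_inv_one_add
  have hw := continuousOn_fst_comp continuousOn_wgt
  have hR := continuousOn_fst_comp P.continuousOn_R
  have cF2 := P.cF2.continuousOn (s := Ioi (0 : ℝ) ×ˢ (univ : Set ℝ))
  have cF12 := P.cF12.continuousOn (s := Ioi (0 : ℝ) ×ˢ (univ : Set ℝ))
  have cF22 := P.cF22.continuousOn (s := Ioi (0 : ℝ) ×ˢ (univ : Set ℝ))
  have cΓ : ContinuousOn (fun x : ℝ × ℝ => Gam α x.2) (Ioi 0 ×ˢ univ) :=
    ((continuous_Gam hα).comp continuous_snd).continuousOn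
  have hσ := integrableOn_rpow_sin (s := 1 - α / 10) (by linarith)
  have hH := (integrable_rectMeasure (b := P.b) P.a_pos (φ := fun x : ℝ × ℝ =>
    wgt x.1 ^ 2 * ((P.F2 x + x.1 * P.F12 x - 2 * P.F2 x * (1 / (1 + x.1)) -
        3 * (1 / (1 + x.1)) * (2 * cos (2 * x.2) * P.F2 x + sin (2 * x.2) * P.F22 x)) * P.F2 x))
        (by fun_prop) hσ).fun_add
    (integrable_rectMeasure (b := P.b) P.a_pos (φ := fun x : ℝ × ℝ =>
      2 / 3 * α * (cos x.2 ^ 2 - 2 * sin x.2 ^ 2) * (Gam α x.2 / cGam α) * P.R x.1 *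
        (wgt x.1 * P.F2 x)) (by fun_prop) (integrableOn_rpow_sin (s := -(α / 10)) (by linarith)))
  refine ⟨hH, ?_⟩
  have n1 := integral_radial_transport_eq_zero P.a_pos P.a_lt_b P.cF2 P.cF12 P.d21
    (P.van2 _ (by simp)) (P.van2 _ (by simp)) hσ
  have n2 := integral_angular_transport_eq_zero (b := P.b) P.a_pos P.cF2 P.cF22 P.d22
    (k := fun z => 3 * (1 / (1 + z)) * wgt z ^ 2)
    ((continuousOn_const.mul continuousOn_inv_one_add).mul (continuousOn_wgt.pow 2))
    (s := α / 10 - 1) (by linarith)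
  have i1 := integrable_rectMeasure (b := P.b) P.a_pos
    (φ := fun x => (wgt x.1 * P.F2 x) ^ 2) (by fun_prop) hσ
  have i2 := integrable_rectMeasure (b := P.b) P.a_pos
    (φ := fun x => P.R x.1 ^ 2) (by fun_prop)
    (integrableOn_rpow_sin (s := -(1 - 17 * α / 30)) (by linarith))
  have := sum_mul_integral_le ![39 / 100, -(6 * α ^ 2), 1, -(1 / 2)] ![_, _, _, _] _
    (by simpa [Fin.forall_fin_succ] using ⟨i1, i2, n1.1, n2.1⟩) hH ?_
  · simp only [Fin.sum_univ_four, Matrix.cons_val] at this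
    rw [n1.2, n2.2] at this
    linarith
  refine ae_rectMeasure fun z hz θ hθ => ?_
  simp only [Fin.sum_univ_four, Matrix.cons_val]
  have hS := sin_two_mul_pos hθ
  have hτ := Gam_sq_mul_rpow_le hα hθ
  have e1 : sin (2 * θ) ^ (1 - α / 10) = sin (2 * θ) ^ 2 * sin (2 * θ) ^ (-(1 + α / 10)) := by
    rw [← rpow_two, ← rpow_add hS]; congr 1; ring
  have e2 : sin (2 * θ) ^ (1 - (α / 10 - 1)) =
      sin (2 * θ) ^ 3 * sin (2 * θ) ^ (-(1 + α / 10)) := by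
    rw [← rpow_natCast, ← rpow_add hS]; congr 1; push_cast; ring
  have e3 : sin (2 * θ) ^ (-(α / 10)) = sin (2 * θ) * sin (2 * θ) ^ (-(1 + α / 10)) := by
    nth_rw 2 [← rpow_one (sin (2 * θ))]
    rw [← rpow_add hS]; congr 1; ring
  rw [show -(α / 10 - 1) = 1 - α / 10 by ring, e1, e2, e3]
  have hs0 := rpow_pos_of_pos hS (-(1 + α / 10))
  set s1 := sin (2 * θ) ^ (-(1 + α / 10))
  set τ := sin (2 * θ) ^ (-(1 - 17 * α / 30))
  have hz0 : 0 < z := P.a_pos.trans hz.1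
  obtain ⟨hv0, hv1, -⟩ := inv_one_add_bounds hz0
  have hC : 1 / (1 + z) * cos (2 * θ) ≤ 1 := by
    nlinarith [cos_le_one (2 * θ)]
  have hc := nine_tenths_le_cGam hα hα'
  have hc2 : (1 / cGam α) ^ 2 ≤ 100 / 81 := by
    rw [div_pow, div_le_div_iff₀ (by positivity) (by norm_num)]
    nlinarith
  have hm : (2 / 3 * (cos θ ^ 2 - 2 * sin θ ^ 2)) ^ 2 ≤ 16 / 9 := by
    have := sin_sq_add_cos_sq θ
    nlinarith [sq_nonneg (sin θ), sq_nonneg (cos θ)]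
  have hτ0 : 0 ≤ Gam α θ ^ 2 * s1 := by positivity
  have hmc : (2 / 3 * (cos θ ^ 2 - 2 * sin θ ^ 2)) ^ 2 * (1 / cGam α) ^ 2 ≤ 16 / 9 * (100 / 81) := by
    gcongr
  have key : 5 / 2 * ((2 / 3 * (cos θ ^ 2 - 2 * sin θ ^ 2)) ^ 2 * (1 / cGam α) ^ 2 *
      (Gam α θ ^ 2 * s1)) ≤ 6 * τ := by
    have := mul_le_mul hmc hτ hτ0 (by norm_num)
    linarith
  have key1 := mul_le_mul_of_nonneg_left key (by positivity : 0 ≤ α ^ 2 * P.R z ^ 2)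
  have key2 := mul_nonneg (sq_nonneg (wgt z * P.F2 (z, θ) * sin (2 * θ) +
    5 * (2 / 3 * α * (cos θ ^ 2 - 2 * sin θ ^ 2) * (Gam α θ * (1 / cGam α)) * P.R z))) hs0.le
  have hX : 0 ≤ (wgt z * P.F2 (z, θ) * sin (2 * θ)) ^ 2 * s1 := by positivity
  have k2 := mul_le_mul_of_nonneg_right hC hX
  have k3 := mul_le_mul_of_nonneg_left k2 (by positivity : 0 ≤ 3 / 10 * α)
  have k4 := mul_le_mul_of_nonneg_right hα'.le hX
  rw [div_eq_mul_one_div (Gam α θ)]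
  linarith

/-- Cauchy–Schwarz in the angular variable. -/
theorem integral_g_sq_le :
    ∫ z in Ioo P.a P.b, (wgt z * P.g z) ^ 2 ≤
      18 / 5 * ∫ x, (wgt x.1 * P.F x) ^ 2 ∂rectMeasure P.a P.b := by
  have hw := continuousOn_fst_comp continuousOn_wgt
  have cF := P.cF.continuousOn (s := Ioi (0 : ℝ) ×ˢ (univ : Set ℝ))
  have i1 := integrable_rectMeasure' (b := P.b) P.a_pos
    (φ := fun x => (wgt x.1 * P.F x) ^ 2) (by fun_prop)
  rw [integral_rectMeasure i1, ← integral_const_mul]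
  refine setIntegral_mono_on (integrableOn_Ioo_of_pos P.a_pos
    ((continuousOn_wgt.mul P.continuous_g.continuousOn).pow 2))
    (Integrable.const_mul (Integrable.integral_prod_left i1) _) measurableSet_Ioo fun z hz => ?_
  have h := sq_integral_mul_Kker_le (P.cF.comp (by fun_prop : Continuous fun θ : ℝ => (z, θ)))
  simp only [mul_pow]
  rw [integral_const_mul]
  have := mul_le_mul_of_nonneg_left h (sq_nonneg (wgt z))
  simp only [Function.comp_def] at this
  unfold g
  linarith

end StripData

theorem integral_rectMeasure_mul {a b : ℝ} (k ρ : ℝ → ℝ) :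
    ∫ x, k x.1 * ρ x.2 ∂rectMeasure a b =
      (∫ z in Ioo a b, k z) * ∫ θ in Ioo 0 (π / 2), ρ θ :=
  integral_prod_mul k ρ

namespace StripData

variable (P : StripData)

theorem integral_g_div_sq_le :
    ∫ z in Ioo P.a P.b, (P.g z / z) ^ 2 ≤
      9 / 40 * ∫ x, (wgt x.1 * P.F x) ^ 2 ∂rectMeasure P.a P.b := by
  have h : ∫ z in Ioo P.a P.b, (P.g z / z) ^ 2 ≤
      ∫ z in Ioo P.a P.b, 1 / 16 * (wgt z * P.g z) ^ 2 := by
    refine setIntegral_mono_on (integrableOn_Ioo_of_pos P.a_pos (P.continuousOn_g_div.fun_pow 2))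
      (Integrable.const_mul (integrableOn_Ioo_of_pos P.a_pos
        ((continuousOn_wgt.mul P.continuous_g.continuousOn).pow 2)) _) measurableSet_Ioo
      fun z hz => ?_
    have hz0 : 0 < z := P.a_pos.trans hz.1
    have h1 : (4 / z) ^ 2 ≤ wgt z ^ 2 := pow_le_pow_left₀ (by positivity) (four_div_le_wgt hz0) 2
    have h2 := mul_le_mul_of_nonneg_right h1 (sq_nonneg (P.g z))
    calc (P.g z / z) ^ 2 = 1 / 16 * ((4 / z) ^ 2 * P.g z ^ 2) := by field_simp; norm_num
      _ ≤ 1 / 16 * (wgt z ^ 2 * P.g z ^ 2) := by linarith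
      _ = _ := by ring
  rw [integral_const_mul] at h
  linarith [P.integral_g_sq_le]

theorem integral_G_div_sq_le :
    ∫ z in Ioo P.a P.b, (P.G z / z) ^ 2 ≤
      9 / 10 * ∫ x, (wgt x.1 * P.F x) ^ 2 ∂rectMeasure P.a P.b := by
  have := integral_sq_div_le P.a_pos P.a_lt_b P.continuous_g P.cG P.dG P.Ga P.Gb
  linarith [P.integral_g_div_sq_le]

theorem integral_Dth_sq_le {α : ℝ} (hα : 0 < α) (hα' : α < 1 / 100) :
    Integrable (fun x => (wgt x.1 * (sin (2 * x.2) * P.F2 x)) ^ 2) (rectMeasure P.a P.b) ∧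
    ∫ x, (wgt x.1 * (sin (2 * x.2) * P.F2 x)) ^ 2 ∂rectMeasure P.a P.b ≤
      ∫ x, (wgt x.1 * P.F2 x) ^ 2 * sin (2 * x.2) ^ (1 - α / 10) ∂rectMeasure P.a P.b := by
  have hw := continuousOn_fst_comp continuousOn_wgt
  have cF2 := P.cF2.continuousOn (s := Ioi (0 : ℝ) ×ˢ (univ : Set ℝ))
  have i1 := integrable_rectMeasure' (b := P.b) P.a_pos
    (φ := fun x => (wgt x.1 * (sin (2 * x.2) * P.F2 x)) ^ 2) (by fun_prop)
  refine ⟨i1, integral_mono_ae i1 (integrable_rectMeasure P.a_pos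
    (φ := fun x => (wgt x.1 * P.F2 x) ^ 2) (by fun_prop)
    (integrableOn_rpow_sin (s := 1 - α / 10) (by linarith))) (ae_rectMeasure fun z hz θ hθ => ?_)⟩
  have hT := mul_le_mul_of_nonneg_left (sin_two_mul_sq_le hα hθ)
    (sq_nonneg (wgt z * P.F2 (z, θ)))
  simp only
  linarith

theorem ell_sq_le {α : ℝ} (hα : 0 < α) (hα' : α < 1 / 100) :
    P.ell ^ 2 ≤
      2 * ∫ x, (wgt x.1 * P.F2 x) ^ 2 * sin (2 * x.2) ^ (1 - α / 10) ∂rectMeasure P.a P.b := by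
  obtain ⟨i1, h1⟩ := P.integral_Dth_sq_le hα hα'
  have hv := continuousOn_fst_comp continuousOn_inv_one_add
  have hw := continuousOn_fst_comp continuousOn_wgt
  have cF2 := P.cF2.continuousOn (s := Ioi (0 : ℝ) ×ˢ (univ : Set ℝ))
  have hK : ContinuousOn (fun x : ℝ × ℝ => Kker x.2) (Ioi 0 ×ˢ univ) :=
    (continuous_Kker.comp continuous_snd).continuousOn
  have i2 := integrable_rectMeasure' (b := P.b) P.a_pos
    (φ := fun x => (3 * (x.1 * (1 / (1 + x.1)) ^ 2) * (1 / (1 + x.1)) * Kker x.2) ^ 2) (by fun_prop)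
  have i3 := integrable_rectMeasure' (b := P.b) P.a_pos
    (φ := fun x => (3 * (x.1 * (1 / (1 + x.1)) ^ 2) * (1 / (1 + x.1)) * Kker x.2) *
      (wgt x.1 * (sin (2 * x.2) * P.F2 x))) (by fun_prop)
  have i4 := integrable_rectMeasure' (b := P.b) P.a_pos
    (φ := fun x => (1 / (1 + x.1)) ^ 2 * (81 / 64)) (by fun_prop)
  have e : P.ell = ∫ x, (3 * (x.1 * (1 / (1 + x.1)) ^ 2) * (1 / (1 + x.1)) * Kker x.2) *
      (wgt x.1 * (sin (2 * x.2) * P.F2 x)) ∂rectMeasure P.a P.b := by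
    refine integral_congr_ae (ae_rectMeasure fun z hz θ _ => ?_)
    have hz0 : 0 < z := P.a_pos.trans hz.1
    simp only [wgt]
    field_simp
  have hcs := sq_integral_mul_le i2 i1 i3
  rw [← e] at hcs
  have hb : ∫ x, (3 * (x.1 * (1 / (1 + x.1)) ^ 2) * (1 / (1 + x.1)) * Kker x.2) ^ 2
      ∂rectMeasure P.a P.b ≤ 2 := by
    refine (integral_mono_ae i2 i4 (ae_rectMeasure fun z hz θ hθ => ?_)).trans ?_
    · obtain ⟨hv0, hv1, hv2⟩ := inv_one_add_bounds (P.a_pos.trans hz.1)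
      have hz0 : 0 < z := P.a_pos.trans hz.1
      have k1 := Kker_nonneg (Ioo_subset_Icc_self hθ)
      have k2 := Kker_le (Ioo_subset_Icc_self hθ)
      simp only
      calc (3 * (z * (1 / (1 + z)) ^ 2) * (1 / (1 + z)) * Kker θ) ^ 2
          ≤ (3 * (1 / 4) * (1 / (1 + z)) * (3 / 2)) ^ 2 := by gcongr
        _ = _ := by ring
    · have := integral_rectMeasure_mul (a := P.a) (b := P.b) (fun z => (1 / (1 + z)) ^ 2)
        fun _ => 81 / 64
      rw [this, integral_const_angle]
      have h2 := integral_inv_one_add_sq_le P.a_pos P.a_lt_b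
      nlinarith [Real.pi_lt_d2, Real.pi_pos]
  refine hcs.trans (mul_le_mul hb h1 (integral_nonneg fun _ => sq_nonneg _) (by norm_num))

theorem integral_ell_sq_le :
    ∫ x, (P.ell * (1 / (1 + x.1))) ^ 2 ∂rectMeasure P.a P.b ≤ 8 / 5 * P.ell ^ 2 := by
  have e := integral_rectMeasure_mul (a := P.a) (b := P.b) (fun z => (1 / (1 + z)) ^ 2)
    fun _ => P.ell ^ 2
  simp only [mul_pow, mul_comm (P.ell ^ 2)]
  rw [e, integral_const_angle]
  have h2 := integral_inv_one_add_sq_le P.a_pos P.a_lt_b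
  have h3 : π / 2 ≤ 8 / 5 := by linarith [Real.pi_lt_d2]
  have h4 : (∫ z in Ioo P.a P.b, (1 / (1 + z)) ^ 2) * (π / 2) ≤ 1 * (8 / 5) :=
    mul_le_mul h2 h3 (by positivity) (by norm_num)
  have := mul_le_mul_of_nonneg_right h4 (sq_nonneg P.ell)
  linarith

theorem integral_R_sq_le :
    ∫ z in Ioo P.a P.b, P.R z ^ 2 ≤
      8 * (∫ z in Ioo P.a P.b, (P.G z / z) ^ 2) + 8 * P.ell ^ 2 := by
  have i1 := integrableOn_Ioo_of_pos (b := P.b) P.a_pos (P.continuousOn_G_div.fun_pow 2)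
  have i2 := integrableOn_Ioo_of_pos (b := P.b) P.a_pos (continuousOn_inv_one_add.fun_pow 2)
  have h : ∫ z in Ioo P.a P.b, P.R z ^ 2 ≤ ∫ z in Ioo P.a P.b,
      (8 * (P.G z / z) ^ 2 + 8 * P.ell ^ 2 * (1 / (1 + z)) ^ 2) := by
    refine setIntegral_mono_on (integrableOn_Ioo_of_pos P.a_pos (P.continuousOn_R.pow 2))
      ((i1.const_mul _).add (i2.const_mul _)) measurableSet_Ioo fun z hz => ?_
    unfold R
    nlinarith [sq_nonneg (P.G z / z + P.ell * (1 / (1 + z)))]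
  rw [integral_add (i1.const_mul _) (i2.const_mul _), integral_const_mul, integral_const_mul] at h
  have := mul_le_mul_of_nonneg_left (integral_inv_one_add_sq_le P.a_pos P.a_lt_b)
    (by positivity : 0 ≤ 8 * P.ell ^ 2)
  linarith

theorem integral_R1_sq_le :
    ∫ z in Ioo P.a P.b, P.R1 z ^ 2 ≤
      12 * (∫ z in Ioo P.a P.b, (P.G z / z) ^ 2) +
      12 * (∫ z in Ioo P.a P.b, (P.g z / z) ^ 2) + 48 * P.ell ^ 2 := by
  have i1 := integrableOn_Ioo_of_pos (b := P.b) P.a_pos (P.continuousOn_G_div.fun_pow 2)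
  have i2 := integrableOn_Ioo_of_pos (b := P.b) P.a_pos (P.continuousOn_g_div.fun_pow 2)
  have i3 := integrableOn_Ioo_of_pos (b := P.b) P.a_pos (continuousOn_inv_one_add.fun_pow 2)
  have h : ∫ z in Ioo P.a P.b, P.R1 z ^ 2 ≤ ∫ z in Ioo P.a P.b,
      (12 * (P.G z / z) ^ 2 + 12 * (P.g z / z) ^ 2 + 48 * P.ell ^ 2 * (1 / (1 + z)) ^ 2) := by
    refine setIntegral_mono_on (integrableOn_Ioo_of_pos P.a_pos (P.continuousOn_R1.pow 2))
      (((i1.const_mul _).add (i2.const_mul _)).add (i3.const_mul _)) measurableSet_Ioo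
      fun z hz => ?_
    have hz0 : 0 < z := P.a_pos.trans hz.1
    have b1 : ((1 - z) * (1 / (1 + z))) ^ 2 ≤ 1 := by
      rw [mul_one_div, div_pow, div_le_one (by positivity)]
      nlinarith
    have b2 : ((2 - z) * (1 / (1 + z))) ^ 2 ≤ 4 := by
      rw [mul_one_div, div_pow, div_le_iff₀ (by positivity)]
      nlinarith
    have c1 := mul_le_mul_of_nonneg_right b1 (sq_nonneg (P.G z / z))
    have c2 := mul_le_mul_of_nonneg_right b2 (sq_nonneg (P.ell * (1 / (1 + z))))
    have hs : ∀ x y t : ℝ, (x + y + t) ^ 2 ≤ 3 * (x ^ 2 + y ^ 2 + t ^ 2) := fun x y t => by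
      nlinarith [sq_nonneg (x - y), sq_nonneg (y - t), sq_nonneg (x - t)]
    refine (hs _ _ _).trans ?_
    linarith
  rw [integral_add ((i1.const_mul _).fun_add (i2.const_mul _)) (i3.const_mul _),
    integral_add (i1.const_mul _) (i2.const_mul _), integral_const_mul, integral_const_mul,
    integral_const_mul] at h
  have := mul_le_mul_of_nonneg_left (integral_inv_one_add_sq_le P.a_pos P.a_lt_b)
    (by positivity : 0 ≤ 48 * P.ell ^ 2)
  linarith

theorem integral_nonlocal_le {α : ℝ} (hα : 0 < α) (hα' : α < 1 / 100) :
    ∫ x, P.G x.1 / x.1 * wgt x.1 * (Gam α x.2 * P.F x) ∂rectMeasure P.a P.b ≤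
      1 / 25 * (∫ z in Ioo P.a P.b, (P.G z / z) ^ 2) +
      75 * ∫ x, (wgt x.1 * P.F2 x) ^ 2 * sin (2 * x.2) ^ (1 - α / 10) ∂rectMeasure P.a P.b := by
  obtain ⟨i1, h1⟩ := P.integral_Dth_sq_le hα hα'
  have hw := continuousOn_fst_comp continuousOn_wgt
  have hG := continuousOn_fst_comp P.continuousOn_G_div
  have cF := P.cF.continuousOn (s := Ioi (0 : ℝ) ×ˢ (univ : Set ℝ))
  have cΓ : ContinuousOn (fun x : ℝ × ℝ => Gam α x.2) (Ioi 0 ×ˢ univ) :=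
    ((continuous_Gam hα).comp continuous_snd).continuousOn
  have i2 := integrable_rectMeasure' (b := P.b) P.a_pos
    (φ := fun x => P.G x.1 / x.1 * wgt x.1 * (Gam α x.2 * P.F x)) (by fun_prop)
  have j1 := integrableOn_Ioo_of_pos (b := P.b) P.a_pos (P.continuousOn_G_div.fun_pow 2)
  have j2 := integrableOn_Ioo_of_pos (b := P.b) P.a_pos
    ((P.continuousOn_G_div.fun_mul continuousOn_wgt).fun_mul P.continuous_g.continuousOn)
  have j3 : IntegrableOn (fun z => ∫ θ in Ioo 0 (π / 2),
      (wgt z * (sin (2 * θ) * P.F2 (z, θ))) ^ 2) (Ioo P.a P.b) := Integrable.integral_prod_left i1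
  have hm := integral_Gam_mem hα
  set m := ∫ θ in Ioo 0 (π / 2), Gam α θ with hm'
  have h : ∫ z in Ioo P.a P.b, ∫ θ in Ioo 0 (π / 2),
        P.G z / z * wgt z * (Gam α θ * P.F (z, θ)) ≤
      ∫ z in Ioo P.a P.b, (m * (P.G z / z * wgt z * P.g z) + 1 / 25 * (P.G z / z) ^ 2 +
        75 * ∫ θ in Ioo 0 (π / 2), (wgt z * (sin (2 * θ) * P.F2 (z, θ))) ^ 2) := by
    refine setIntegral_mono_on (Integrable.integral_prod_left i2)
      (((j2.const_mul _).add (j1.const_mul _)).add (j3.const_mul _)) measurableSet_Ioo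
      fun z hz => ?_
    have key := sq_integral_Gam_mul_sub_le hα (h := fun θ => P.F (z, θ))
      (h' := fun θ => P.F2 (z, θ)) (P.cF.comp (by fun_prop)) (P.cF2.comp (by fun_prop)) (P.d2 z)
    rw [← hm'] at key
    simp only [mul_pow (wgt z)]
    rw [integral_const_mul, integral_const_mul]
    change ((∫ θ in Ioo 0 (π / 2), Gam α θ * P.F (z, θ)) - m * P.g z) ^ 2 ≤ _ at key
    have k1 := mul_le_mul_of_nonneg_left key (sq_nonneg (wgt z))
    nlinarith [sq_nonneg (2 * (P.G z / z) - 25 * (wgt z *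
      ((∫ θ in Ioo 0 (π / 2), Gam α θ * P.F (z, θ)) - m * P.g z)))]
  rw [integral_add ((j2.const_mul _).fun_add (j1.const_mul _)) (j3.const_mul _),
    integral_add (j2.const_mul _) (j1.const_mul _), integral_const_mul, integral_const_mul,
    integral_const_mul, ← integral_rectMeasure i2, ← integral_rectMeasure i1] at h
  have h5 := integral_div_mul_wgt_mul_nonpos P.a_pos P.a_lt_b P.continuous_g P.cG P.dG P.Ga P.Gb
  have h6 := mul_nonneg hm.1 (neg_nonneg.2 h5)
  linarith

theorem integral_sq_F_nonneg : 0 ≤ ∫ x, (wgt x.1 * P.F x) ^ 2 ∂rectMeasure P.a P.b :=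
  integral_nonneg fun _ => sq_nonneg _

theorem integral_sq_mul_rpow_nonneg (φ : ℝ × ℝ → ℝ) (s : ℝ) :
    0 ≤ ∫ x, φ x ^ 2 * sin (2 * x.2) ^ s ∂rectMeasure P.a P.b :=
  integral_nonneg_of_ae (ae_rectMeasure fun _ _ _ hθ =>
    mul_nonneg (sq_nonneg _) (rpow_nonneg (sin_two_mul_pos hθ).le _))

theorem integral_rho_le : ∫ θ in Ioo 0 (π / 2), sin (2 * θ) ^ (-(99 / 100) : ℝ) ≤ 400 :=
  (integral_rpow_neg_sin (by norm_num) (by norm_num)).2.trans (by norm_num)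

theorem integral_R_sq_le' {α : ℝ} (hα : 0 < α) (hα' : α < 1 / 100) :
    ∫ z in Ioo P.a P.b, P.R z ^ 2 ≤ 8 * (∫ x, (wgt x.1 * P.F x) ^ 2 ∂rectMeasure P.a P.b) +
      16 * ∫ x, (wgt x.1 * P.F2 x) ^ 2 * sin (2 * x.2) ^ (1 - α / 10) ∂rectMeasure P.a P.b := by
  linarith [P.integral_R_sq_le, P.integral_G_div_sq_le, P.ell_sq_le hα hα', P.integral_sq_F_nonneg]

theorem integral_R_sq_rho_le {α : ℝ} (hα : 0 < α) (hα' : α < 1 / 100) :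
    ∫ x, P.R x.1 ^ 2 * sin (2 * x.2) ^ (-(99 / 100) : ℝ) ∂rectMeasure P.a P.b ≤
      400 * (8 * (∫ x, (wgt x.1 * P.F x) ^ 2 ∂rectMeasure P.a P.b) +
      16 * ∫ x, (wgt x.1 * P.F2 x) ^ 2 * sin (2 * x.2) ^ (1 - α / 10)
        ∂rectMeasure P.a P.b) := by
  rw [integral_rectMeasure_mul (fun z => P.R z ^ 2) fun θ => sin (2 * θ) ^ (-(99 / 100) : ℝ)]
  have h0 : 0 ≤ ∫ z in Ioo P.a P.b, P.R z ^ 2 := integral_nonneg fun _ => sq_nonneg _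
  have := mul_le_mul_of_nonneg_left integral_rho_le h0
  linarith [P.integral_R_sq_le' hα hα']

theorem integral_R1_sq_rho_le {α : ℝ} (hα : 0 < α) (hα' : α < 1 / 100) :
    ∫ x, P.R1 x.1 ^ 2 * sin (2 * x.2) ^ (-(99 / 100) : ℝ) ∂rectMeasure P.a P.b ≤
      400 * (14 * (∫ x, (wgt x.1 * P.F x) ^ 2 ∂rectMeasure P.a P.b) +
      96 * ∫ x, (wgt x.1 * P.F2 x) ^ 2 * sin (2 * x.2) ^ (1 - α / 10)
        ∂rectMeasure P.a P.b) := by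
  rw [integral_rectMeasure_mul (fun z => P.R1 z ^ 2) fun θ => sin (2 * θ) ^ (-(99 / 100) : ℝ)]
  have h0 : 0 ≤ ∫ z in Ioo P.a P.b, P.R1 z ^ 2 := integral_nonneg fun _ => sq_nonneg _
  have := mul_le_mul_of_nonneg_left integral_rho_le h0
  linarith [P.integral_R1_sq_le, P.integral_G_div_sq_le, P.integral_g_div_sq_le,
    P.ell_sq_le hα hα', P.integral_sq_F_nonneg]

theorem integral_R_sq_tau_le {α : ℝ} (hα : 0 < α) (hα' : α < 1 / 100) :
    α ^ 2 * (∫ x, P.R x.1 ^ 2 * sin (2 * x.2) ^ (-(1 - 17 * α / 30)) ∂rectMeasure P.a P.b) ≤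
      8 * α * (8 * (∫ x, (wgt x.1 * P.F x) ^ 2 ∂rectMeasure P.a P.b) +
      16 * ∫ x, (wgt x.1 * P.F2 x) ^ 2 * sin (2 * x.2) ^ (1 - α / 10)
        ∂rectMeasure P.a P.b) := by
  rw [integral_rectMeasure_mul (fun z => P.R z ^ 2) fun θ => sin (2 * θ) ^ (-(1 - 17 * α / 30))]
  have h0 : 0 ≤ ∫ z in Ioo P.a P.b, P.R z ^ 2 := integral_nonneg fun _ => sq_nonneg _
  have h1 := (integral_rpow_neg_sin (s := 1 - 17 * α / 30) (by linarith) (by linarith)).2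
  have h2 : α * (4 / (1 - (1 - 17 * α / 30))) ≤ 8 := by
    rw [sub_sub_cancel]
    field_simp
    norm_num
  have h3 := (mul_le_mul_of_nonneg_left h1 hα.le).trans h2
  have h4 := mul_le_mul_of_nonneg_left h3 (mul_nonneg hα.le h0)
  have h5 := mul_le_mul_of_nonneg_left (P.integral_R_sq_le' hα hα') (by positivity : 0 ≤ 8 * α)
  linarith

end StripData

/-- A smooth function of two variables has continuous first and second partial derivatives, and
its mixed partial derivatives agree. -/
theorem exists_partials {F : ℝ × ℝ → ℝ} (hF : ContDiff ℝ (⊤ : ℕ∞) F) :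
    ∃ F1 F2 F11 F12 F22 : ℝ × ℝ → ℝ, Continuous F1 ∧ Continuous F2 ∧ Continuous F11 ∧
      Continuous F12 ∧ Continuous F22 ∧
      (∀ z θ, HasDerivAt (fun s => F (s, θ)) (F1 (z, θ)) z) ∧
      (∀ z θ, HasDerivAt (fun t => F (z, t)) (F2 (z, θ)) θ) ∧
      (∀ z θ, HasDerivAt (fun s => F1 (s, θ)) (F11 (z, θ)) z) ∧
      (∀ z θ, HasDerivAt (fun t => F1 (z, t)) (F12 (z, θ)) θ) ∧
      (∀ z θ, HasDerivAt (fun s => F2 (s, θ)) (F12 (z, θ)) z) ∧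
      (∀ z θ, HasDerivAt (fun t => F2 (z, t)) (F22 (z, θ)) θ) := by
  have step : ∀ Φ : ℝ × ℝ → ℝ, ContDiff ℝ (⊤ : ℕ∞) Φ →
      ContDiff ℝ (⊤ : ℕ∞) (fderiv ℝ Φ) ∧ (∀ v, ContDiff ℝ (⊤ : ℕ∞) fun x => fderiv ℝ Φ x v) ∧
      (∀ z θ, HasDerivAt (fun s => Φ (s, θ)) (fderiv ℝ Φ (z, θ) (1, 0)) z) ∧
      (∀ z θ, HasDerivAt (fun t => Φ (z, t)) (fderiv ℝ Φ (z, θ) (0, 1)) θ) := by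
    intro Φ hΦ
    have h1 : ContDiff ℝ (⊤ : ℕ∞) (fderiv ℝ Φ) := hΦ.fderiv_right (by simp)
    have hd : ∀ x, HasFDerivAt Φ (fderiv ℝ Φ x) x := fun x =>
      ((hΦ.differentiable (by simp)) x).hasFDerivAt
    refine ⟨h1, fun v => h1.clm_apply contDiff_const, fun z θ => ?_, fun z θ => ?_⟩
    · exact (hd (z, θ)).comp_hasDerivAt z ((hasDerivAt_id' z).prodMk (hasDerivAt_const z θ))
    · exact (hd (z, θ)).comp_hasDerivAt θ ((hasDerivAt_const θ z).prodMk (hasDerivAt_id' θ))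
  obtain ⟨h', hv, hd1, hd2⟩ := step F hF
  obtain ⟨-, hv1, hd11, hd12⟩ := step _ (hv (1, 0))
  obtain ⟨-, hv2, hd21, hd22⟩ := step _ (hv (0, 1))
  refine ⟨_, _, _, _, _, (hv (1, 0)).continuous, (hv (0, 1)).continuous, (hv1 (1, 0)).continuous,
    (hv1 (0, 1)).continuous, (hv2 (0, 1)).continuous, hd1, hd2, hd11, hd12, fun z θ => ?_, hd22⟩
  refine (hd21 z θ).congr_deriv ?_
  have hsymm : IsSymmSndFDerivAt ℝ F (z, θ) :=
    hF.contDiffAt.isSymmSndFDerivAt (by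
      rw [minSmoothness_of_isRCLikeNormedField]
      exact WithTop.coe_le_coe.2 (le_top : (2 : ℕ∞) ≤ ⊤))
  have hdd : DifferentiableAt ℝ (fderiv ℝ F) (z, θ) := h'.differentiable (by simp) _
  have e : ∀ v w, fderiv ℝ (fun x => fderiv ℝ F x v) (z, θ) w =
      fderiv ℝ (fderiv ℝ F) (z, θ) w v := by
    intro v w
    have := fderiv_clm_apply hdd (differentiableAt_const (c := v))
    rw [this]
    simp
  rw [e, e]
  exact hsymm.eq _ _

theorem continuous_integral_mul_Kker {F : ℝ × ℝ → ℝ} (hF : Continuous F) :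
    Continuous fun z => ∫ θ in Ioo 0 (π / 2), F (z, θ) * Kker θ := by
  have hK := continuous_Kker
  have h := intervalIntegral.continuous_parametric_intervalIntegral_of_continuous' (μ := volume)
    (f := fun z θ => F (z, θ) * Kker θ)
    (by simp only [Function.uncurry_def]; fun_prop) 0 (π / 2)
  simpa only [intervalIntegral.integral_of_le (by positivity : (0 : ℝ) ≤ π / 2),
    integral_Ioc_eq_integral_Ioo] using h

theorem L12_eq (f : ℝ → ℝ → ℝ) (z : ℝ) :
    L12 f z = ∫ r in Ioi z, (∫ θ in Ioo 0 (π / 2), f r θ * Kker θ) / r := by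
  unfold L12
  simp_rw [integral_Icc_eq_integral_Ioo, integral_div]

theorem exists_stripData {f : ℝ → ℝ → ℝ} (hf : Admissible f) (hf0 : L12 f 0 = 0) :
    ∃ P : StripData, P.F = Function.uncurry f ∧ ∀ z, 0 < z → P.G z = L12 f z := by
  obtain ⟨hs, a, b, ha, hv⟩ := hf
  set F := Function.uncurry f with hFdef
  obtain ⟨F1, F2, F11, F12, F22, c1, c2, c11, c12, c22, d1, d2, d11, d12, d21, d22⟩ :=
    exists_partials hs
  have cF : Continuous F := hs.continuous
  set g : ℝ → ℝ := fun z => ∫ θ in Ioo 0 (π / 2), F (z, θ) * Kker θ with hgdef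
  have cg : Continuous g := continuous_integral_mul_Kker cF
  have hgv : ∀ z, z ∉ Icc a b → g z = 0 := fun z hz => by
    have : ∀ θ, F (z, θ) = 0 := fun θ => hv z θ hz
    simp [hgdef, this]
  set a' := a / 2 with ha'
  set b' := max b a + 1 with hb'
  have hb1 : b < b' := by linarith [le_max_left b a]
  have hb2 : a < b' := by linarith [le_max_right b a]
  have ha0 : 0 < a' := by positivity
  have haa : a' < a := by linarith
  have hout : ∀ z, z ∉ Ioo a' b' → z ∉ Icc a b := fun z hz hz' =>
    hz ⟨haa.trans_le hz'.1, hz'.2.trans_lt hb1⟩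
  have hnhds : ∀ z, z ∉ Icc a b → ∀ᶠ s in nhds z, s ∉ Icc a b := fun z hz =>
    isClosed_Icc.isOpen_compl.eventually_mem hz
  set h : ℝ → ℝ := fun r => g r / r with hh
  have hhv : ∀ r, r ∉ Icc a b → h r = 0 := fun r hr => by simp [hh, hgv r hr]
  have ch : Continuous h := by
    rw [continuous_iff_continuousAt]
    intro r
    rcases eq_or_ne r 0 with rfl | hr
    · have : h =ᶠ[nhds 0] fun _ => 0 :=
        (hnhds 0 fun h0 => absurd h0.1 (not_le.2 ha)).mono fun s hs => hhv s hs
      exact continuousAt_const.congr this.symm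
    · exact cg.continuousAt.div continuousAt_id hr
  have hint : Integrable h := ch.integrable_of_hasCompactSupport
    (HasCompactSupport.of_support_subset_isCompact (isCompact_Icc (a := a) (b := b)) fun r hr => by
      by_contra hc
      exact hr (hhv r hc))
  set G : ℝ → ℝ := fun z => -∫ r in (0 : ℝ)..z, h r with hG
  have dG : ∀ z, HasDerivAt G (-(g z / z)) z := fun z =>
    (ch.integral_hasStrictDerivAt 0 z).hasDerivAt.fun_neg
  have hGL : ∀ z, G z = L12 f z := by
    intro z
    have e0 := L12_eq f 0
    rw [hf0] at e0
    have := intervalIntegral.integral_interval_add_Ioi (a := 0) (b := z)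
      hint.integrableOn hint.integrableOn
    rw [L12_eq]
    change (∫ r in (0 : ℝ)..z, h r) + ∫ r in Ioi z, h r = ∫ r in Ioi 0, h r at this
    change 0 = ∫ r in Ioi 0, h r at e0
    change -(∫ r in (0 : ℝ)..z, h r) = ∫ r in Ioi z, h r
    linarith
  refine ⟨{
    a := a', b := b', a_pos := ha0, a_lt_b := by linarith, F := F, F1 := F1, F2 := F2
    F11 := F11, F12 := F12, F22 := F22, cF := cF, cF1 := c1, cF2 := c2, cF11 := c11, cF12 := c12
    cF22 := c22, d1 := d1, d2 := d2, d11 := d11, d12 := d12, d21 := d21, d22 := d22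
    van := fun z hz θ => hv z θ (hout z hz)
    van1 := fun z hz θ => ?_
    van2 := fun z hz θ => ?_
    G := G
    cG := continuous_iff_continuousAt.2 fun z => (dG z).continuousAt
    cg := cg
    dG := fun z _ => dG z
    Ga := ?_
    Gb := ?_ }, rfl, fun z _ => hGL z⟩
  · exact (d1 z θ).unique ((hasDerivAt_const z (0 : ℝ)).congr_of_eventuallyEq
      ((hnhds z (hout z hz)).mono fun s hs => hv s θ hs))
  · exact (d2 z θ).unique ((hasDerivAt_const θ (0 : ℝ)).congr_of_eventuallyEq
      (Eventually.of_forall fun t => hv z t (hout z hz)))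
  · have : ∫ r in (0 : ℝ)..a', h r = ∫ r in (0 : ℝ)..a', (0 : ℝ) :=
      intervalIntegral.integral_congr fun r hr => by
        rw [uIcc_of_le ha0.le] at hr
        exact hhv r fun hc => absurd hc.1 (not_le.2 (hr.2.trans_lt haa))
    simp only [hG]
    rw [this]
    simp
  · rw [hGL, L12_eq]
    exact setIntegral_eq_zero_of_forall_eq_zero fun r hr =>
      hhv r fun hc => absurd (hc.2.trans_lt hb1) (not_lt.2 (le_of_lt hr))

namespace StripData

variable (P : StripData) {f : ℝ → ℝ → ℝ}

theorem apply_eq (hF : P.F = Function.uncurry f) (z θ : ℝ) : f z θ = P.F (z, θ) := by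
  rw [hF]; rfl

theorem Dzr_eq (hF : P.F = Function.uncurry f) (z θ : ℝ) : Dzr f z θ = z * P.F1 (z, θ) := by
  have := (P.d1 z θ).deriv
  rw [hF] at this
  rw [Dzr, ← this]
  rfl

theorem Dth_eq (hF : P.F = Function.uncurry f) (z θ : ℝ) :
    Dth f z θ = sin (2 * θ) * P.F2 (z, θ) := by
  have := (P.d2 z θ).deriv
  rw [hF] at this
  rw [Dth, ← this]
  rfl

theorem L12_Dth_eq (hF : P.F = Function.uncurry f) :
    L12 (fun z θ => 3 / (1 + z) * Dth f z θ) 0 = P.ell := by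
  have hv := continuousOn_fst_comp continuousOn_inv_one_add
  have hi : ContinuousOn (fun x : ℝ × ℝ => 1 / x.1) (Ioi 0 ×ˢ univ) :=
    continuousOn_fst_comp (k := fun z => 1 / z) (continuousOn_const.div continuousOn_id
      fun _ hz => (mem_Ioi.1 hz).ne')
  have cF2 := P.cF2.continuousOn (s := Ioi (0 : ℝ) ×ˢ (univ : Set ℝ))
  have hK : ContinuousOn (fun x : ℝ × ℝ => Kker x.2) (Ioi 0 ×ˢ univ) :=
    (continuous_Kker.comp continuous_snd).continuousOn
  have i1 := integrable_rectMeasure' (b := P.b) P.a_pos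
    (φ := fun x => 3 * (1 / x.1 * (1 / (1 + x.1))) * (sin (2 * x.2) * P.F2 x * Kker x.2))
    (by fun_prop)
  have i2 : Integrable (fun x => 3 / (x.1 * (1 + x.1)) * (sin (2 * x.2) * P.F2 x * Kker x.2))
      (rectMeasure P.a P.b) := i1.congr (ae_of_all _ fun x => by
    simp only
    rw [one_div_mul_one_div, mul_one_div])
  rw [ell, ← ip_eq_integral P.a_pos i2 (A := fun z θ => 3 / (1 + z) * Dth f z θ)
    (B := fun z θ => Kker θ / z)]
  · simp only [L12, ip, mul_div_assoc]
  · intro z hz θ _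
    have hz0 : 0 < z := P.a_pos.trans hz.1
    rw [P.Dth_eq hF]
    field_simp
  · intro z hz θ
    rw [P.Dth_eq hF, P.van2 z hz]
    simp

theorem LGamT_eq (hF : P.F = Function.uncurry f) (hG : ∀ z, 0 < z → P.G z = L12 f z) (α : ℝ)
    {z : ℝ} (hz : 0 < z) (θ : ℝ) :
    LGamT α f z θ = P.F (z, θ) + z * P.F1 (z, θ) - 2 * P.F (z, θ) * (1 / (1 + z)) -
      3 * (1 / (1 + z)) * (sin (2 * θ) * P.F2 (z, θ)) +
      Gam α θ / cGam α * (P.R z / wgt z) := by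
  have h1 := P.Dzr_eq hF z θ
  rw [Dzr] at h1
  rw [LGamT, LGam, Lop, Pproj, P.L12_Dth_eq hF, P.Dth_eq hF, h1, P.apply_eq hF, ← hG z hz, R, wgt]
  field_simp
  ring

theorem hasDerivAt_R_div_wgt {z : ℝ} (hz : 0 < z) :
    HasDerivAt (fun s => P.R s / wgt s) (P.R1 z / wgt z / z) z := by
  have hw := hasDerivAt_wgt hz
  have hw0 := wgt_pos hz
  have h1 : (1 : ℝ) + z ≠ 0 := by positivity
  have hv := (hasDerivAt_const z (1 : ℝ)).fun_div ((hasDerivAt_id' z).const_add 1) h1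
  have hR := (((P.dG z hz).fun_div (hasDerivAt_id' z) hz.ne').const_mul (-2)).fun_add
    (hv.const_mul (2 * P.ell))
  refine (hR.fun_div hw hw0.ne').congr_deriv ?_
  rw [R1, g]
  generalize wgt z = W at hw0 ⊢
  field_simp
  ring

theorem Dzr_LGamT_eq (hF : P.F = Function.uncurry f) (hG : ∀ z, 0 < z → P.G z = L12 f z) (α : ℝ)
    {z : ℝ} (hz : 0 < z) (θ : ℝ) :
    Dzr (LGamT α f) z θ = z * P.F1 (z, θ) + z * (P.F1 (z, θ) + z * P.F11 (z, θ)) -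
        2 * (z * P.F1 (z, θ)) * (1 / (1 + z)) + 2 * (z * (1 / (1 + z)) ^ 2) * P.F (z, θ) +
        3 * (z * (1 / (1 + z)) ^ 2) * (sin (2 * θ) * P.F2 (z, θ)) -
        3 * (1 / (1 + z)) * (sin (2 * θ) * (z * P.F12 (z, θ))) +
        Gam α θ / cGam α * (P.R1 z / wgt z) := by
  have h1 : (1 : ℝ) + z ≠ 0 := by positivity
  have hv := (hasDerivAt_const z (1 : ℝ)).fun_div ((hasDerivAt_id' z).const_add 1) h1
  have hd := (((((P.d1 z θ).fun_add ((hasDerivAt_id' z).fun_mul (P.d11 z θ))).fun_sub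
    (((P.d1 z θ).const_mul 2).fun_mul hv)).fun_sub
    ((hv.const_mul 3).fun_mul ((P.d21 z θ).const_mul (sin (2 * θ))))).fun_add
    ((P.hasDerivAt_R_div_wgt hz).const_mul (Gam α θ / cGam α)))
  have hd' := hd.congr_of_eventuallyEq (f₁ := fun s => LGamT α f s θ)
    ((isOpen_Ioi.eventually_mem hz).mono fun s hs => P.LGamT_eq hF hG α hs θ)
  rw [Dzr, hd'.deriv]
  have hw0 := wgt_pos hz
  generalize wgt z = W at hw0 ⊢
  field_simp
  ring

theorem Dth_LGamT_eq (hF : P.F = Function.uncurry f) (hG : ∀ z, 0 < z → P.G z = L12 f z) (α : ℝ)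
    {z : ℝ} (hz : 0 < z) {θ : ℝ} (hθ : θ ∈ Ioo 0 (π / 2)) :
    Dth (LGamT α f) z θ = sin (2 * θ) * (P.F2 (z, θ) + z * P.F12 (z, θ) -
        2 * P.F2 (z, θ) * (1 / (1 + z)) - 3 * (1 / (1 + z)) *
          (2 * cos (2 * θ) * P.F2 (z, θ) + sin (2 * θ) * P.F22 (z, θ))) +
      2 / 3 * α * (cos θ ^ 2 - 2 * sin θ ^ 2) * (Gam α θ / cGam α) * (P.R z / wgt z) := by
  obtain ⟨Γ', hΓ, he⟩ := hasDerivAt_Gam (α := α) hθ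
  have hS : HasDerivAt (fun t => sin (2 * t)) (cos (2 * θ) * 2) θ := by
    simpa using (((hasDerivAt_id' θ).const_mul 2).sin)
  have hd := (((((P.d2 z θ).fun_add ((P.d12 z θ).const_mul z)).fun_sub
    (((P.d2 z θ).const_mul 2).mul_const (1 / (1 + z)))).fun_sub
    ((hS.fun_mul (P.d22 z θ)).const_mul (3 * (1 / (1 + z))))).fun_add
    ((hΓ.div_const (cGam α)).mul_const (P.R z / wgt z)))
  have hd' := hd.congr_of_eventuallyEq (f₁ := fun t => LGamT α f z t)
    (Eventually.of_forall fun t => P.LGamT_eq hF hG α hz t)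
  rw [Dth, hd'.deriv]
  linear_combination (1 / cGam α * (P.R z / wgt z)) * he

end StripData

theorem div_rpow_half_mul_self {S : ℝ} (hS : 0 < S) (x s : ℝ) :
    x / S ^ (s / 2) * (x / S ^ (s / 2)) = x ^ 2 * S ^ (-s) := by
  rw [div_mul_div_comm, ← rpow_add hS, add_halves, rpow_neg hS.le, div_eq_mul_inv, sq]

namespace StripData

variable (P : StripData) {f : ℝ → ℝ → ℝ}

theorem ipH1_LGamT_eq (hF : P.F = Function.uncurry f) (hG : ∀ z, 0 < z → P.G z = L12 f z) {α : ℝ}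
    (hα : 0 < α) (hα' : α < 1 / 100) :
    ipH1 (99 / 100) (1 + α / 10) (LGamT α f) f =
      10 * (∫ x, (wgt x.1 ^ 2 * ((x.1 * P.F1 x + x.1 * (P.F1 x + x.1 * P.F11 x) -
        2 * (x.1 * P.F1 x) * (1 / (1 + x.1)) + 2 * (x.1 * (1 / (1 + x.1)) ^ 2) * P.F x +
        3 * (x.1 * (1 / (1 + x.1)) ^ 2) * (sin (2 * x.2) * P.F2 x) -
        3 * (1 / (1 + x.1)) * (sin (2 * x.2) * (x.1 * P.F12 x))) * (x.1 * P.F1 x)) +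
        Gam α x.2 / cGam α * P.R1 x.1 * (wgt x.1 * (x.1 * P.F1 x))) *
        sin (2 * x.2) ^ (-(99 / 100) : ℝ) ∂rectMeasure P.a P.b) +
      10 ^ 10 * (∫ x, (wgt x.1 ^ 2 * ((P.F x + x.1 * P.F1 x - 2 * P.F x * (1 / (1 + x.1)) -
        3 * (1 / (1 + x.1)) * (sin (2 * x.2) * P.F2 x)) * P.F x) +
        Gam α x.2 / cGam α * P.R x.1 * (wgt x.1 * P.F x)) * sin (2 * x.2) ^ (-(99 / 100) : ℝ)
        ∂rectMeasure P.a P.b) +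
      10 ^ 17 * (∫ x, (wgt x.1 ^ 2 * ((P.F x + x.1 * P.F1 x - 2 * P.F x * (1 / (1 + x.1)) -
        3 * (1 / (1 + x.1)) * (sin (2 * x.2) * P.F2 x)) * P.F x) +
        Gam α x.2 / cGam α * P.R x.1 * (wgt x.1 * P.F x)) ∂rectMeasure P.a P.b) +
      10 ^ 21 * (∫ x, (wgt x.1 ^ 2 * ((P.F2 x + x.1 * P.F12 x - 2 * P.F2 x * (1 / (1 + x.1)) -
        3 * (1 / (1 + x.1)) * (2 * cos (2 * x.2) * P.F2 x + sin (2 * x.2) * P.F22 x)) * P.F2 x) *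
        sin (2 * x.2) ^ (1 - α / 10) +
      2 / 3 * α * (cos x.2 ^ 2 - 2 * sin x.2 ^ 2) * (Gam α x.2 / cGam α) * P.R x.1 *
        (wgt x.1 * P.F2 x) * sin (2 * x.2) ^ (-(α / 10))) ∂rectMeasure P.a P.b) := by
  rw [ipH1, ip_eq_integral P.a_pos (P.integral_Dz_ge hα hα').1,
    ip_eq_integral P.a_pos (P.integral_weighted_ge hα hα').1,
    ip_eq_integral P.a_pos (P.integral_unweighted_ge hα hα').1,
    ip_eq_integral P.a_pos (P.integral_Dth_ge hα hα').1]
  · intro z hz θ hθ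
    have hz0 : 0 < z := P.a_pos.trans hz.1
    have hS := sin_two_mul_pos hθ
    have hw := wgt_pos hz0
    rw [P.Dth_LGamT_eq hF hG α hz0 hθ, P.Dth_eq hF, div_eq_mul_inv _ (sin (2 * θ) ^ (1 + α / 10)),
      ← rpow_neg hS.le,
      show sin (2 * θ) ^ (1 - α / 10) = sin (2 * θ) ^ 2 * sin (2 * θ) ^ (-(1 + α / 10)) by
        rw [← rpow_two, ← rpow_add hS]; congr 1; ring,
      show sin (2 * θ) ^ (-(α / 10)) = sin (2 * θ) * sin (2 * θ) ^ (-(1 + α / 10)) by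
        nth_rw 2 [← rpow_one (sin (2 * θ))]
        rw [← rpow_add hS]; congr 1; ring]
    generalize sin (2 * θ) ^ (-(1 + α / 10)) = s at *
    generalize wgt z = W at hw ⊢
    field_simp
  · intro z hz θ
    rw [P.Dth_eq hF, P.van2 z hz]
    simp
  · intro z hz θ hθ
    have hz0 : 0 < z := P.a_pos.trans hz.1
    have hw := wgt_pos hz0
    rw [P.LGamT_eq hF hG α hz0, P.apply_eq hF]
    generalize wgt z = W at hw ⊢
    field_simp
  · intro z hz θ
    rw [P.apply_eq hF z, P.van z hz]
    simp
  · intro z hz θ hθ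
    have hz0 : 0 < z := P.a_pos.trans hz.1
    have hw := wgt_pos hz0
    rw [P.LGamT_eq hF hG α hz0, P.apply_eq hF, div_eq_mul_inv _ (sin (2 * θ) ^ (99 / 100 : ℝ)),
      ← rpow_neg (sin_two_mul_pos hθ).le]
    generalize sin (2 * θ) ^ (-(99 / 100) : ℝ) = s at *
    generalize wgt z = W at hw ⊢
    field_simp
  · intro z hz θ
    rw [P.apply_eq hF z, P.van z hz]
    simp
  · intro z hz θ hθ
    have hz0 : 0 < z := P.a_pos.trans hz.1
    have hw := wgt_pos hz0
    rw [P.Dzr_LGamT_eq hF hG α hz0, P.Dzr_eq hF, div_eq_mul_inv _ (sin (2 * θ) ^ (99 / 100 : ℝ)),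
      ← rpow_neg (sin_two_mul_pos hθ).le]
    generalize sin (2 * θ) ^ (-(99 / 100) : ℝ) = s at *
    generalize wgt z = W at hw ⊢
    field_simp
  · intro z hz θ
    rw [P.Dzr_eq hF z, P.van1 z hz]
    simp

theorem H1normSq_eq (hF : P.F = Function.uncurry f) {α : ℝ} (hα' : α < 1 / 100) :
    H1normSq (99 / 100) (1 + α / 10) f =
      (∫ x, (wgt x.1 * P.F x) ^ 2 * sin (2 * x.2) ^ (-(99 / 100) : ℝ) ∂rectMeasure P.a P.b) +
      (∫ x, (wgt x.1 * (x.1 * P.F1 x)) ^ 2 * sin (2 * x.2) ^ (-(99 / 100) : ℝ)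
        ∂rectMeasure P.a P.b) +
      ∫ x, (wgt x.1 * P.F2 x) ^ 2 * sin (2 * x.2) ^ (1 - α / 10) ∂rectMeasure P.a P.b := by
  have hw := continuousOn_fst_comp continuousOn_wgt
  have cF := P.cF.continuousOn (s := Ioi (0 : ℝ) ×ˢ (univ : Set ℝ))
  have cF1 := P.cF1.continuousOn (s := Ioi (0 : ℝ) ×ˢ (univ : Set ℝ))
  have cF2 := P.cF2.continuousOn (s := Ioi (0 : ℝ) ×ˢ (univ : Set ℝ))
  have i1 := integrable_rectMeasure (b := P.b) P.a_pos
    (φ := fun x => (wgt x.1 * P.F x) ^ 2) (by fun_prop) integrableOn_rho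
  have i2 := integrable_rectMeasure (b := P.b) P.a_pos
    (φ := fun x => (wgt x.1 * (x.1 * P.F1 x)) ^ 2) (by fun_prop) integrableOn_rho
  have i3 := integrable_rectMeasure (b := P.b) P.a_pos
    (φ := fun x => (wgt x.1 * P.F2 x) ^ 2) (by fun_prop)
    (integrableOn_rpow_sin (s := 1 - α / 10) (by linarith))
  rw [H1normSq, ip_eq_integral P.a_pos i1, ip_eq_integral P.a_pos i2, ip_eq_integral P.a_pos i3]
  · intro z hz θ hθ
    have hS := sin_two_mul_pos hθ
    rw [div_rpow_half_mul_self hS, P.Dth_eq hF,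
      show sin (2 * θ) ^ (1 - α / 10) = sin (2 * θ) ^ 2 * sin (2 * θ) ^ (-(1 + α / 10)) by
        rw [← rpow_two, ← rpow_add hS]; congr 1; ring]
    ring
  · intro z hz θ
    rw [P.Dth_eq hF, P.van2 z hz]
    simp
  · intro z hz θ hθ
    rw [div_rpow_half_mul_self (sin_two_mul_pos hθ), P.Dzr_eq hF, mul_comm (wgt z)]
  · intro z hz θ
    rw [P.Dzr_eq hF z, P.van1 z hz]
    simp
  · intro z hz θ hθ
    rw [div_rpow_half_mul_self (sin_two_mul_pos hθ), P.apply_eq hF, mul_comm (wgt z)]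
  · intro z hz θ
    rw [P.apply_eq hF z, P.van z hz]
    simp

end StripData

/-- `𝓗¹` coercivity of `𝓛_Γ^T`: for `0 < α < 10⁻¹⁴`, `η = 99/100`, `γ = 1 + α/10`,
and every admissible `f` with `L₁₂(f)(0) = 0`, `(𝓛_Γ^T(f), f)_{𝓗¹} ≥ |f|²_{𝓗¹}`. -/
theorem LGamT_H1_coercive (α : ℝ) (hα : 0 < α) (hα' : α < 1 / 10 ^ 14)
    (η γ : ℝ) (hη : η = 99 / 100) (hγ : γ = 1 + α / 10)
    (f : ℝ → ℝ → ℝ) (hf : Admissible f) (hf0 : L12 f 0 = 0) :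
    ipH1 η γ (LGamT α f) f ≥ H1normSq η γ f := by
  subst hη hγ
  obtain ⟨P, hF, hG⟩ := exists_stripData hf hf0
  have hα1 : α < 1 / 100 := hα'.trans (by norm_num)
  rw [P.ipH1_LGamT_eq hF hG hα hα1, P.H1normSq_eq hF hα1, ge_iff_le]
  have hc : 2 / cGam α ≤ 20 / 9 := by
    have := nine_tenths_le_cGam hα hα1
    rw [div_le_div_iff₀ (by positivity) (by norm_num)]
    linarith
  have hc0 : 0 ≤ 2 / cGam α := by
    have := nine_tenths_le_cGam hα hα1
    positivity
  have e1 := (P.integral_Dz_ge hα hα1).2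
  have e2 := (P.integral_weighted_ge hα hα1).2
  have e3 := (P.integral_unweighted_ge hα hα1).2
  have e4 := (P.integral_Dth_ge hα hα1).2
  have b1 := P.integral_R1_sq_rho_le hα hα1
  have b2 := P.integral_R_sq_rho_le hα hα1
  have b3 := P.integral_R_sq_tau_le hα hα1
  have b4 := P.integral_ell_sq_le
  have b5 := P.ell_sq_le hα hα1
  have b6 := P.integral_nonlocal_le hα hα1
  have b7 := P.integral_G_div_sq_le
  have hE := P.integral_sq_F_nonneg
  have hA := P.integral_sq_mul_rpow_nonneg (fun x => wgt x.1 * (x.1 * P.F1 x)) (-(99 / 100))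
  have hB := P.integral_sq_mul_rpow_nonneg (fun x => wgt x.1 * P.F x) (-(99 / 100))
  have hT := P.integral_sq_mul_rpow_nonneg (fun x => wgt x.1 * P.F2 x) (1 - α / 10)
  have b8 := mul_le_mul_of_nonneg_left (b6.trans (add_le_add_left
    (mul_le_mul_of_nonneg_left b7 (by norm_num : (0 : ℝ) ≤ 1 / 25)) _)) hc0
  have b9 := b8.trans (mul_le_mul_of_nonneg_right hc (by positivity))
  have b10 := b3.trans (mul_le_mul_of_nonneg_right
    (by linarith : 8 * α ≤ 8 * (1 / 10 ^ 14)) (by positivity))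
  linarith
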